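/- arXiv:0706.0040 — 5 statements merged into one kernel-verified Lean document; each statement's English description precedes it below -/
import Mathlib

section
/- Let k be a field, (H, c) a cocommutative braided Hopf algebra over k, and (A, s) a left H-module algebra with action ρ. Let f, f' ∈ Reg₊ˢ(H², A) both satisfy the 2-cocycle condition δ⁰(f) * δ²(f) = δ³(f) * δ¹(f) (convolution in Hom_k(H^{⊗3}, A) with respect to Δ_{H³}). Then the crossed products A#_f H and A#_{f'} H are equivalent if and only if there exists u ∈ Reg₊ˢ(H, A) such that δ⁰(u) * δ²(u) * f' = f * δ¹(u) in Hom_k(H^{⊗2}, A); equivalently, if and only if f * (f')⁻¹ lies in the image of the coboundary map D¹(u) := δ⁰(u) * δ¹(u)⁻¹ * δ²(u). Consequently the second braided Sweedler cohomology group H²(H, A, s) is in bijective correspondence with the set of equivalence classes of crossed products of (A, s) with H whose cocycle is convolution invertible. -/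
open TensorProduct LinearMap

noncomputable section

set_option maxHeartbeats 1000000

/-- The data of a braided Hopf algebra structure `(H, c, S)` (on the given algebra and
coalgebra structures of `H`) together with a left `H`-braided module algebra structure
`(A, s, ρ)`. -/
structure ModAlgData (k H A : Type*) [Field k] [Ring H] [Algebra k H] [Coalgebra k H]
    [Ring A] [Algebra k A] where
  /-- the braid of `H` -/
  c : H ⊗[k] H →ₗ[k] H ⊗[k] H
  /-- the antipode of `H` -/
  antipode : H →ₗ[k] H
  /-- the left transposition of `H` on `A` -/
  s : H ⊗[k] A →ₗ[k] A ⊗[k] H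
  /-- the action of `H` on `A` -/
  ρ : H ⊗[k] A →ₗ[k] A
  c_bij : Function.Bijective c
  s_bij : Function.Bijective s
  /-- `Δ(1) = 1⊗1` -/
  comul_one : Coalgebra.comul (R := k) (1 : H) = (1 : H) ⊗ₜ[k] (1 : H)
  /-- `ε(1) = 1` -/
  counit_one : Coalgebra.counit (R := k) (1 : H) = 1
  /-- `ε(hl) = ε(h)ε(l)` -/
  counit_mul : ∀ x y : H, Coalgebra.counit (R := k) (x * y) =
    Coalgebra.counit (R := k) x * Coalgebra.counit (R := k) y
  /-- `c(1⊗h) = h⊗1` -/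
  c_one_left : ∀ h : H, c ((1 : H) ⊗ₜ[k] h) = h ⊗ₜ[k] (1 : H)
  /-- `c(h⊗1) = 1⊗h` -/
  c_one_right : ∀ h : H, c (h ⊗ₜ[k] (1 : H)) = (1 : H) ⊗ₜ[k] h
  /-- `c∘(μ⊗H) = (H⊗μ)∘(c⊗H)∘(H⊗c)` -/
  c_mul_left : c ∘ₗ rTensor H (LinearMap.mul' k H) =
    lTensor H (LinearMap.mul' k H) ∘ₗ (TensorProduct.assoc k H H H).toLinearMap
      ∘ₗ rTensor H c ∘ₗ (TensorProduct.assoc k H H H).symm.toLinearMap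
      ∘ₗ lTensor H c ∘ₗ (TensorProduct.assoc k H H H).toLinearMap
  /-- `c∘(H⊗μ) = (μ⊗H)∘(H⊗c)∘(c⊗H)` -/
  c_mul_right : c ∘ₗ lTensor H (LinearMap.mul' k H) =
    rTensor H (LinearMap.mul' k H) ∘ₗ (TensorProduct.assoc k H H H).symm.toLinearMap
      ∘ₗ lTensor H c ∘ₗ (TensorProduct.assoc k H H H).toLinearMap
      ∘ₗ rTensor H c ∘ₗ (TensorProduct.assoc k H H H).symm.toLinearMap
  /-- `(H⊗Δ)∘c = (c⊗H)∘(H⊗c)∘(Δ⊗H)` -/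
  c_comul_left : lTensor H (Coalgebra.comul (R := k)) ∘ₗ c =
    (TensorProduct.assoc k H H H).toLinearMap ∘ₗ rTensor H c
      ∘ₗ (TensorProduct.assoc k H H H).symm.toLinearMap ∘ₗ lTensor H c
      ∘ₗ (TensorProduct.assoc k H H H).toLinearMap ∘ₗ rTensor H (Coalgebra.comul (R := k))
  /-- `(Δ⊗H)∘c = (H⊗c)∘(c⊗H)∘(H⊗Δ)` -/
  c_comul_right : rTensor H (Coalgebra.comul (R := k)) ∘ₗ c =
    (TensorProduct.assoc k H H H).symm.toLinearMap ∘ₗ lTensor H c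
      ∘ₗ (TensorProduct.assoc k H H H).toLinearMap ∘ₗ rTensor H c
      ∘ₗ (TensorProduct.assoc k H H H).symm.toLinearMap ∘ₗ lTensor H (Coalgebra.comul (R := k))
  /-- `(H⊗ε)∘c = ε⊗H` -/
  c_counit_left : (TensorProduct.rid k H).toLinearMap
      ∘ₗ lTensor H (Coalgebra.counit (R := k)) ∘ₗ c =
    (TensorProduct.lid k H).toLinearMap ∘ₗ rTensor H (Coalgebra.counit (R := k))
  /-- `(ε⊗H)∘c = H⊗ε` -/
  c_counit_right : (TensorProduct.lid k H).toLinearMap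
      ∘ₗ rTensor H (Coalgebra.counit (R := k)) ∘ₗ c =
    (TensorProduct.rid k H).toLinearMap ∘ₗ lTensor H (Coalgebra.counit (R := k))
  /-- `Δ∘μ = (μ⊗μ)∘(H⊗c⊗H)∘(Δ⊗Δ)` -/
  comul_mul : Coalgebra.comul (R := k) ∘ₗ LinearMap.mul' k H =
    TensorProduct.map (LinearMap.mul' k H) (LinearMap.mul' k H)
      ∘ₗ (TensorProduct.assoc k H H (H ⊗[k] H)).symm.toLinearMap
      ∘ₗ lTensor H ((TensorProduct.assoc k H H H).toLinearMap ∘ₗ rTensor H c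
          ∘ₗ (TensorProduct.assoc k H H H).symm.toLinearMap)
      ∘ₗ (TensorProduct.assoc k H H (H ⊗[k] H)).toLinearMap
      ∘ₗ TensorProduct.map (Coalgebra.comul (R := k)) (Coalgebra.comul (R := k))
  /-- `μ∘(S⊗H)∘Δ = η∘ε` -/
  antipode_left : LinearMap.mul' k H ∘ₗ rTensor H antipode ∘ₗ Coalgebra.comul (R := k) =
    Algebra.linearMap k H ∘ₗ Coalgebra.counit (R := k)
  /-- `μ∘(H⊗S)∘Δ = η∘ε` -/
  antipode_right : LinearMap.mul' k H ∘ₗ lTensor H antipode ∘ₗ Coalgebra.comul (R := k) =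
    Algebra.linearMap k H ∘ₗ Coalgebra.counit (R := k)
  /-- `s(1⊗a) = a⊗1` -/
  s_one_left : ∀ a : A, s ((1 : H) ⊗ₜ[k] a) = a ⊗ₜ[k] (1 : H)
  /-- `s(h⊗1) = 1⊗h` -/
  s_one_right : ∀ h : H, s (h ⊗ₜ[k] (1 : A)) = (1 : A) ⊗ₜ[k] h
  /-- `s∘(μ⊗A) = (A⊗μ)∘(s⊗H)∘(H⊗s)` -/
  s_mul_H : s ∘ₗ rTensor A (LinearMap.mul' k H) =
    lTensor A (LinearMap.mul' k H) ∘ₗ (TensorProduct.assoc k A H H).toLinearMap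
      ∘ₗ rTensor H s ∘ₗ (TensorProduct.assoc k H A H).symm.toLinearMap
      ∘ₗ lTensor H s ∘ₗ (TensorProduct.assoc k H H A).toLinearMap
  /-- `(A⊗ε)∘s = ε⊗A` -/
  s_counit : (TensorProduct.rid k A).toLinearMap
      ∘ₗ lTensor A (Coalgebra.counit (R := k)) ∘ₗ s =
    (TensorProduct.lid k A).toLinearMap ∘ₗ rTensor A (Coalgebra.counit (R := k))
  /-- `(A⊗Δ)∘s = (s⊗H)∘(H⊗s)∘(Δ⊗A)` -/
  s_comul : lTensor A (Coalgebra.comul (R := k)) ∘ₗ s =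
    (TensorProduct.assoc k A H H).toLinearMap ∘ₗ rTensor H s
      ∘ₗ (TensorProduct.assoc k H A H).symm.toLinearMap ∘ₗ lTensor H s
      ∘ₗ (TensorProduct.assoc k H H A).toLinearMap ∘ₗ rTensor A (Coalgebra.comul (R := k))
  /-- `(s⊗H)∘(H⊗s)∘(c⊗A) = (A⊗c)∘(s⊗H)∘(H⊗s)` -/
  s_braid : (TensorProduct.assoc k A H H).toLinearMap ∘ₗ rTensor H s
      ∘ₗ (TensorProduct.assoc k H A H).symm.toLinearMap ∘ₗ lTensor H s
      ∘ₗ (TensorProduct.assoc k H H A).toLinearMap ∘ₗ rTensor A c =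
    lTensor A c ∘ₗ (TensorProduct.assoc k A H H).toLinearMap ∘ₗ rTensor H s
      ∘ₗ (TensorProduct.assoc k H A H).symm.toLinearMap ∘ₗ lTensor H s
      ∘ₗ (TensorProduct.assoc k H H A).toLinearMap
  /-- `s∘(H⊗μ_A) = (μ_A⊗H)∘(A⊗s)∘(s⊗A)` -/
  s_mul_A : s ∘ₗ lTensor H (LinearMap.mul' k A) =
    rTensor H (LinearMap.mul' k A) ∘ₗ (TensorProduct.assoc k A A H).symm.toLinearMap
      ∘ₗ lTensor A s ∘ₗ (TensorProduct.assoc k A H A).toLinearMap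
      ∘ₗ rTensor A s ∘ₗ (TensorProduct.assoc k H A A).symm.toLinearMap
  /-- `ρ(1⊗a) = a` -/
  ρ_one : ∀ a : A, ρ ((1 : H) ⊗ₜ[k] a) = a
  /-- `ρ∘(μ⊗A) = ρ∘(H⊗ρ)` -/
  ρ_mul : ρ ∘ₗ rTensor A (LinearMap.mul' k H) =
    ρ ∘ₗ lTensor H ρ ∘ₗ (TensorProduct.assoc k H H A).toLinearMap
  /-- `s∘(H⊗ρ) = (ρ⊗H)∘(H⊗s)∘(c⊗A)` -/
  s_ρ : s ∘ₗ lTensor H ρ =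
    rTensor H ρ ∘ₗ (TensorProduct.assoc k H A H).symm.toLinearMap ∘ₗ lTensor H s
      ∘ₗ (TensorProduct.assoc k H H A).toLinearMap ∘ₗ rTensor A c
      ∘ₗ (TensorProduct.assoc k H H A).symm.toLinearMap
  /-- `ρ∘(H⊗μ_A) = μ_A∘(ρ⊗ρ)∘(H⊗s⊗A)∘(Δ⊗A⊗A)` -/
  ρ_mul_A : ρ ∘ₗ lTensor H (LinearMap.mul' k A) =
    LinearMap.mul' k A ∘ₗ TensorProduct.map ρ ρ
      ∘ₗ (TensorProduct.assoc k H A (H ⊗[k] A)).symm.toLinearMap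
      ∘ₗ lTensor H ((TensorProduct.assoc k A H A).toLinearMap ∘ₗ rTensor A s
          ∘ₗ (TensorProduct.assoc k H A A).symm.toLinearMap)
      ∘ₗ (TensorProduct.assoc k H H (A ⊗[k] A)).toLinearMap
      ∘ₗ rTensor (A ⊗[k] A) (Coalgebra.comul (R := k))
  /-- `ρ(h⊗1) = ε(h)1` -/
  ρ_unit : ∀ h : H, ρ (h ⊗ₜ[k] (1 : A)) = Coalgebra.counit (R := k) h • (1 : A)

variable {k H A : Type*} [Field k] [Ring H] [Algebra k H] [Coalgebra k H]
  [Ring A] [Algebra k A]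

/-- `(H, c)` is cocommutative: `c∘c = id` and `c∘Δ = Δ`. -/
def ModAlgData.Cocomm (D : ModAlgData k H A) : Prop :=
  D.c ∘ₗ D.c = LinearMap.id ∧
    D.c ∘ₗ Coalgebra.comul (R := k) = Coalgebra.comul (R := k)

/-- The convolution product on `Hom_k(H, A)`. -/
def conv1 (f g : H →ₗ[k] A) : H →ₗ[k] A :=
  LinearMap.mul' k A ∘ₗ TensorProduct.map f g ∘ₗ Coalgebra.comul (R := k)

/-- The convolution unit `η_A∘ε` on `Hom_k(H, A)`. -/
def unit1 : H →ₗ[k] A :=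
  Algebra.linearMap k A ∘ₗ Coalgebra.counit (R := k)

/-- The map `χ := (ρ⊗H)∘(H⊗s)∘(Δ⊗A) : H⊗A → A⊗H`. -/
def ModAlgData.χ (D : ModAlgData k H A) : H ⊗[k] A →ₗ[k] A ⊗[k] H :=
  rTensor H D.ρ ∘ₗ (TensorProduct.assoc k H A H).symm.toLinearMap ∘ₗ lTensor H D.s
    ∘ₗ (TensorProduct.assoc k H H A).toLinearMap
    ∘ₗ rTensor A (Coalgebra.comul (R := k))

variable (D : ModAlgData k H A)

/-- `c¹₂ : H⊗(H⊗H) → (H⊗H)⊗H`. -/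
def ModAlgData.c2 : H ⊗[k] (H ⊗[k] H) →ₗ[k] (H ⊗[k] H) ⊗[k] H :=
  (TensorProduct.assoc k H H H).symm.toLinearMap ∘ₗ lTensor H D.c
    ∘ₗ (TensorProduct.assoc k H H H).toLinearMap ∘ₗ rTensor H D.c
    ∘ₗ (TensorProduct.assoc k H H H).symm.toLinearMap

/-- `Δ_{H²} := (H⊗c⊗H)∘(Δ⊗Δ) : H⊗H → (H⊗H)⊗(H⊗H)`. -/
def ModAlgData.comul2 : H ⊗[k] H →ₗ[k] (H ⊗[k] H) ⊗[k] (H ⊗[k] H) :=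
  (TensorProduct.assoc k H H (H ⊗[k] H)).symm.toLinearMap
    ∘ₗ lTensor H ((TensorProduct.assoc k H H H).toLinearMap ∘ₗ rTensor H D.c
        ∘ₗ (TensorProduct.assoc k H H H).symm.toLinearMap)
    ∘ₗ (TensorProduct.assoc k H H (H ⊗[k] H)).toLinearMap
    ∘ₗ TensorProduct.map (Coalgebra.comul (R := k)) (Coalgebra.comul (R := k))

/-- `Δ_{H³} : H⊗(H⊗H) → (H⊗(H⊗H))⊗(H⊗(H⊗H))`. -/
def ModAlgData.comul3 :
    H ⊗[k] (H ⊗[k] H) →ₗ[k] (H ⊗[k] (H ⊗[k] H)) ⊗[k] (H ⊗[k] (H ⊗[k] H)) :=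
  (TensorProduct.assoc k H (H ⊗[k] H) (H ⊗[k] (H ⊗[k] H))).symm.toLinearMap
    ∘ₗ lTensor H ((TensorProduct.assoc k (H ⊗[k] H) H (H ⊗[k] H)).toLinearMap
        ∘ₗ rTensor (H ⊗[k] H) D.c2
        ∘ₗ (TensorProduct.assoc k H (H ⊗[k] H) (H ⊗[k] H)).symm.toLinearMap)
    ∘ₗ (TensorProduct.assoc k H H ((H ⊗[k] H) ⊗[k] (H ⊗[k] H))).toLinearMap
    ∘ₗ TensorProduct.map (Coalgebra.comul (R := k)) D.comul2

/-- Convolution on `Hom_k(H⊗H, A)` with respect to `Δ_{H²}`. -/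
def conv2 (f g : H ⊗[k] H →ₗ[k] A) : H ⊗[k] H →ₗ[k] A :=
  LinearMap.mul' k A ∘ₗ TensorProduct.map f g ∘ₗ D.comul2

/-- Convolution on `Hom_k(H^{⊗3}, A)` with respect to `Δ_{H³}`. -/
def conv3 (f g : H ⊗[k] (H ⊗[k] H) →ₗ[k] A) : H ⊗[k] (H ⊗[k] H) →ₗ[k] A :=
  LinearMap.mul' k A ∘ₗ TensorProduct.map f g ∘ₗ D.comul3

/-- The convolution unit on `Hom_k(H⊗H, A)`. -/
def unit2 : H ⊗[k] H →ₗ[k] A :=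
  Algebra.linearMap k A ∘ₗ LinearMap.mul' k k
    ∘ₗ TensorProduct.map (Coalgebra.counit (R := k)) (Coalgebra.counit (R := k))

/-- `s² := (s⊗H)∘(H⊗s) : (H⊗H)⊗A → A⊗(H⊗H)`. -/
def ModAlgData.s2 : (H ⊗[k] H) ⊗[k] A →ₗ[k] A ⊗[k] (H ⊗[k] H) :=
  (TensorProduct.assoc k A H H).toLinearMap ∘ₗ rTensor H D.s
    ∘ₗ (TensorProduct.assoc k H A H).symm.toLinearMap ∘ₗ lTensor H D.s
    ∘ₗ (TensorProduct.assoc k H H A).toLinearMap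

/-- `Reg₊ˢ(H, A)`: normal, compatible with `s`, `s`-central, convolution invertible
maps `H → A`. -/
def Reg1 : Set (H →ₗ[k] A) :=
  {u | D.s ∘ₗ lTensor H u = rTensor H u ∘ₗ D.c ∧
    LinearMap.mul' k A ∘ₗ lTensor A u ∘ₗ D.s = LinearMap.mul' k A ∘ₗ rTensor A u ∧
    u 1 = 1 ∧
    ∃ v, conv1 u v = unit1 ∧ conv1 v u = unit1}

/-- `Reg₊ˢ(H², A)`: normal, compatible with `s`, `s`-central, convolution invertible
maps `H⊗H → A`. -/
def Reg2 : Set (H ⊗[k] H →ₗ[k] A) :=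
  {f | D.s ∘ₗ lTensor H f = rTensor H f ∘ₗ D.c2 ∧
    LinearMap.mul' k A ∘ₗ lTensor A f ∘ₗ D.s2 = LinearMap.mul' k A ∘ₗ rTensor A f ∧
    (∀ h : H, f ((1 : H) ⊗ₜ[k] h) = Coalgebra.counit (R := k) h • (1 : A) ∧
      f (h ⊗ₜ[k] (1 : H)) = Coalgebra.counit (R := k) h • (1 : A)) ∧
    ∃ g, conv2 D f g = unit2 ∧ conv2 D g f = unit2}

/-- `δ⁰(u)(h⊗l) = h·u(l)` for `u : H → A`. -/
def d0₁ (u : H →ₗ[k] A) : H ⊗[k] H →ₗ[k] A := D.ρ ∘ₗ lTensor H u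

/-- `δ¹(u)(h⊗l) = u(hl)`. -/
def d1₁ (u : H →ₗ[k] A) : H ⊗[k] H →ₗ[k] A := u ∘ₗ LinearMap.mul' k H

/-- `δ²(u)(h⊗l) = u(h)ε(l)`. -/
def d2₁ (u : H →ₗ[k] A) : H ⊗[k] H →ₗ[k] A :=
  (TensorProduct.rid k A).toLinearMap ∘ₗ TensorProduct.map u (Coalgebra.counit (R := k))

/-- `δ⁰(f)(h⊗l⊗m) = h·f(l⊗m)` for `f : H⊗H → A`. -/
def d0₂ (f : H ⊗[k] H →ₗ[k] A) : H ⊗[k] (H ⊗[k] H) →ₗ[k] A := D.ρ ∘ₗ lTensor H f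

/-- `δ¹(f)(h⊗l⊗m) = f(hl⊗m)`. -/
def d1₂ (f : H ⊗[k] H →ₗ[k] A) : H ⊗[k] (H ⊗[k] H) →ₗ[k] A :=
  f ∘ₗ rTensor H (LinearMap.mul' k H) ∘ₗ (TensorProduct.assoc k H H H).symm.toLinearMap

/-- `δ²(f)(h⊗l⊗m) = f(h⊗lm)`. -/
def d2₂ (f : H ⊗[k] H →ₗ[k] A) : H ⊗[k] (H ⊗[k] H) →ₗ[k] A :=
  f ∘ₗ lTensor H (LinearMap.mul' k H)

/-- `δ³(f)(h⊗l⊗m) = f(h⊗l)ε(m)`. -/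
def d3₂ (f : H ⊗[k] H →ₗ[k] A) : H ⊗[k] (H ⊗[k] H) →ₗ[k] A :=
  (TensorProduct.rid k A).toLinearMap
    ∘ₗ TensorProduct.map f (Coalgebra.counit (R := k))
    ∘ₗ (TensorProduct.assoc k H H H).symm.toLinearMap

/-- The 2-cocycle condition `δ⁰(f) * δ²(f) = δ³(f) * δ¹(f)`. -/
def IsCocycle2 (f : H ⊗[k] H →ₗ[k] A) : Prop :=
  conv3 D (d0₂ D f) (d2₂ f) = conv3 D (d3₂ f) (d1₂ f)

/-- `F_f := (f⊗μ)∘Δ_{H²} : H⊗H → A⊗H`. -/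
def Ffmap (f : H ⊗[k] H →ₗ[k] A) : H ⊗[k] H →ₗ[k] A ⊗[k] H :=
  TensorProduct.map f (LinearMap.mul' k H) ∘ₗ D.comul2

/-- The crossed product multiplication
`μ_f := (μ_A⊗H)∘(μ_A⊗F_f)∘(A⊗χ⊗H) : (A⊗H)⊗(A⊗H) → A⊗H`. -/
def crossedMul (f : H ⊗[k] H →ₗ[k] A) :
    (A ⊗[k] H) ⊗[k] (A ⊗[k] H) →ₗ[k] A ⊗[k] H :=
  rTensor H (LinearMap.mul' k A) ∘ₗ (TensorProduct.assoc k A A H).symm.toLinearMap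
    ∘ₗ TensorProduct.map (LinearMap.mul' k A) (Ffmap D f)
    ∘ₗ (TensorProduct.assoc k A A (H ⊗[k] H)).symm.toLinearMap
    ∘ₗ lTensor A ((TensorProduct.assoc k A H H).toLinearMap ∘ₗ rTensor H D.χ
        ∘ₗ (TensorProduct.assoc k H A H).symm.toLinearMap)
    ∘ₗ (TensorProduct.assoc k A H (A ⊗[k] H)).toLinearMap

/-- `ŝ := (A⊗c)∘(s⊗H) : H⊗(A⊗H) → (A⊗H)⊗H`. -/
def ModAlgData.shat : H ⊗[k] (A ⊗[k] H) →ₗ[k] (A ⊗[k] H) ⊗[k] H :=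
  (TensorProduct.assoc k A H H).symm.toLinearMap ∘ₗ lTensor A D.c
    ∘ₗ (TensorProduct.assoc k A H H).toLinearMap ∘ₗ rTensor H D.s
    ∘ₗ (TensorProduct.assoc k H A H).symm.toLinearMap

/-- Equivalence of the crossed products `A#_f H` and `A#_{f'} H`: an `A`-linear
`H`-comodule algebra isomorphism. -/
def CrossedEquiv (f f' : H ⊗[k] H →ₗ[k] A) : Prop :=
  ∃ g : A ⊗[k] H →ₗ[k] A ⊗[k] H,
    Function.Bijective g ∧
    g ∘ₗ crossedMul D f = crossedMul D f' ∘ₗ TensorProduct.map g g ∧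
    g ((1 : A) ⊗ₜ[k] (1 : H)) = (1 : A) ⊗ₜ[k] (1 : H) ∧
    (∀ a : A, g ∘ₗ rTensor H (LinearMap.mulLeft k a) =
      rTensor H (LinearMap.mulLeft k a) ∘ₗ g) ∧
    lTensor A (Coalgebra.comul (R := k)) ∘ₗ g =
      (TensorProduct.assoc k A H H).toLinearMap ∘ₗ rTensor H g
        ∘ₗ (TensorProduct.assoc k A H H).symm.toLinearMap
        ∘ₗ lTensor A (Coalgebra.comul (R := k)) ∧
    rTensor H g ∘ₗ D.shat = D.shat ∘ₗ lTensor H g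

/-- The coboundary relation: `f` and `f'` differ by the coboundary of some
`u ∈ Reg₊ˢ(H, A)`, i.e. `δ⁰(u) * δ²(u) * f' = f * δ¹(u)`. -/
def CoboundRel (f f' : H ⊗[k] H →ₗ[k] A) : Prop :=
  ∃ u ∈ Reg1 D, conv2 D (conv2 D (d0₁ D u) (d2₁ u)) f' = conv2 D f (d1₁ u)

/-- `f * (f')⁻¹` lies in the image of the coboundary map
`D¹(u) := δ⁰(u) * δ¹(u)⁻¹ * δ²(u)`. -/
def InCoboundImage (f f' : H ⊗[k] H →ₗ[k] A) : Prop :=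
  ∀ g' : H ⊗[k] H →ₗ[k] A, conv2 D f' g' = unit2 → conv2 D g' f' = unit2 →
    ∃ u ∈ Reg1 D, ∃ w : H ⊗[k] H →ₗ[k] A,
      conv2 D (d1₁ u) w = unit2 ∧ conv2 D w (d1₁ u) = unit2 ∧
      conv2 D f g' = conv2 D (conv2 D (d0₁ D u) w) (d2₁ u)

namespace BraidedCrossedProduct

/-! ### Linear maps acting on the leading factors of a right-nested tensor product -/

section Head

variable {k M N P Q E X Y Z : Type*} [Field k] [AddCommMonoid M] [Module k M]
  [AddCommMonoid N] [Module k N] [AddCommMonoid P] [Module k P] [AddCommMonoid Q] [Module k Q]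
  [AddCommMonoid E] [Module k E]
  [AddCommMonoid X] [Module k X] [AddCommMonoid Y] [Module k Y] [AddCommMonoid Z] [Module k Z]

/-- A map `M → P` acting on the first factor of `M ⊗ X`. -/
def head11 (f : M →ₗ[k] P) : M ⊗[k] X →ₗ[k] P ⊗[k] X := rTensor X f

/-- A functional on `M` acting on the first factor of `M ⊗ X`. -/
def head10 (f : M →ₗ[k] k) : M ⊗[k] X →ₗ[k] X :=
  (TensorProduct.lid k X).toLinearMap ∘ₗ rTensor X f

/-- A map `M → P ⊗ Q` acting on the first factor of `M ⊗ X`. -/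
def head12 (f : M →ₗ[k] P ⊗[k] Q) : M ⊗[k] X →ₗ[k] P ⊗[k] (Q ⊗[k] X) :=
  (TensorProduct.assoc k P Q X).toLinearMap ∘ₗ rTensor X f

/-- A map `M ⊗ N → P` acting on the first two factors of `M ⊗ (N ⊗ X)`. -/
def head21 (f : M ⊗[k] N →ₗ[k] P) : M ⊗[k] (N ⊗[k] X) →ₗ[k] P ⊗[k] X :=
  rTensor X f ∘ₗ (TensorProduct.assoc k M N X).symm.toLinearMap

/-- A map `M ⊗ N → P ⊗ Q` acting on the first two factors of `M ⊗ (N ⊗ X)`. -/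
def head22 (f : M ⊗[k] N →ₗ[k] P ⊗[k] Q) : M ⊗[k] (N ⊗[k] X) →ₗ[k] P ⊗[k] (Q ⊗[k] X) :=
  (TensorProduct.assoc k P Q X).toLinearMap ∘ₗ rTensor X f
    ∘ₗ (TensorProduct.assoc k M N X).symm.toLinearMap

@[simp] theorem head11_tmul (f : M →ₗ[k] P) (a : M) (x : X) :
    head11 f (a ⊗ₜ[k] x) = f a ⊗ₜ x := by simp [head11]

@[simp] theorem head10_tmul (f : M →ₗ[k] k) (a : M) (x : X) :
    head10 f (a ⊗ₜ[k] x) = f a • x := by simp [head10]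

@[simp] theorem head12_tmul (f : M →ₗ[k] P ⊗[k] Q) (a : M) (x : X) :
    head12 f (a ⊗ₜ[k] x) = TensorProduct.assoc k P Q X (f a ⊗ₜ x) := by simp [head12]

@[simp] theorem head21_tmul (f : M ⊗[k] N →ₗ[k] P) (a : M) (b : N) (x : X) :
    head21 f (a ⊗ₜ[k] (b ⊗ₜ[k] x)) = f (a ⊗ₜ b) ⊗ₜ x := by simp [head21]

@[simp] theorem head22_tmul (f : M ⊗[k] N →ₗ[k] P ⊗[k] Q) (a : M) (b : N) (x : X) :
    head22 f (a ⊗ₜ[k] (b ⊗ₜ[k] x)) = TensorProduct.assoc k P Q X (f (a ⊗ₜ b) ⊗ₜ x) := by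
  simp [head22]

theorem induction_two {p : M ⊗[k] (N ⊗[k] X) → Prop} (z : M ⊗[k] (N ⊗[k] X)) (h0 : p 0)
    (ht : ∀ a b x, p (a ⊗ₜ (b ⊗ₜ x))) (ha : ∀ z w, p z → p w → p (z + w)) : p z := by
  induction z with
  | zero => exact h0
  | add z w hz hw => exact ha z w hz hw
  | tmul a y =>
    induction y with
    | zero => simpa using h0
    | add z w hz hw => rw [tmul_add]; exact ha _ _ hz hw
    | tmul b x => exact ht a b x

theorem head11_lTensor (f : M →ₗ[k] P) (φ : X →ₗ[k] Y) (z : M ⊗[k] X) :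
    head11 f (lTensor M φ z) = lTensor P φ (head11 f z) := by
  induction z with
  | zero => simp
  | add z w hz hw => simp [hz, hw]
  | tmul a x => simp

theorem head10_lTensor (f : M →ₗ[k] k) (φ : X →ₗ[k] Y) (z : M ⊗[k] X) :
    head10 f (lTensor M φ z) = φ (head10 f z) := by
  induction z with
  | zero => simp
  | add z w hz hw => simp [hz, hw]
  | tmul a x => simp

theorem assoc_lTensor_lTensor (φ : X →ₗ[k] Y) (t : P ⊗[k] Q) (x : X) :
    TensorProduct.assoc k P Q Y (t ⊗ₜ φ x) =
      lTensor P (lTensor Q φ) (TensorProduct.assoc k P Q X (t ⊗ₜ x)) := by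
  induction t with
  | zero => simp
  | add z w hz hw => simp [add_tmul, hz, hw]
  | tmul a x => simp

theorem head12_lTensor (f : M →ₗ[k] P ⊗[k] Q) (φ : X →ₗ[k] Y) (z : M ⊗[k] X) :
    head12 f (lTensor M φ z) = lTensor P (lTensor Q φ) (head12 f z) := by
  induction z with
  | zero => simp
  | add z w hz hw => simp [hz, hw]
  | tmul a x => simp [assoc_lTensor_lTensor]

theorem head21_lTensor (f : M ⊗[k] N →ₗ[k] P) (φ : X →ₗ[k] Y) (z : M ⊗[k] (N ⊗[k] X)) :
    head21 f (lTensor M (lTensor N φ) z) = lTensor P φ (head21 f z) := by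
  induction z using induction_two with
  | h0 => simp
  | ha z w hz hw => simp [hz, hw]
  | ht a b x => simp

theorem head22_lTensor (f : M ⊗[k] N →ₗ[k] P ⊗[k] Q) (φ : X →ₗ[k] Y)
    (z : M ⊗[k] (N ⊗[k] X)) :
    head22 f (lTensor M (lTensor N φ) z) = lTensor P (lTensor Q φ) (head22 f z) := by
  induction z using induction_two with
  | h0 => simp
  | ha z w hz hw => simp [hz, hw]
  | ht a b x => simp [assoc_lTensor_lTensor]

theorem head11_injective {f g : M →ₗ[k] P}
    (h : ∀ z : M ⊗[k] k, head11 f z = head11 g z) : f = g := by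
  ext a
  have := congrArg (TensorProduct.rid k P) (h (a ⊗ₜ 1))
  simpa using this

theorem head21_injective {f g : M ⊗[k] N →ₗ[k] P}
    (h : ∀ z : M ⊗[k] (N ⊗[k] k), head21 f z = head21 g z) : f = g := by
  ext a b
  have := congrArg (TensorProduct.rid k P) (h (a ⊗ₜ (b ⊗ₜ 1)))
  simpa using this

theorem head22_injective {f g : M ⊗[k] N →ₗ[k] P ⊗[k] Q}
    (h : ∀ z : M ⊗[k] (N ⊗[k] k), head22 f z = head22 g z) : f = g := by
  ext a b
  have := congrArg (fun w => TensorProduct.rid k _ ((TensorProduct.assoc k P Q k).symm w))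
    (h (a ⊗ₜ (b ⊗ₜ 1)))
  simpa using this

/-- Appending the element `x` on the right. -/
def append (x : X) : P →ₗ[k] P ⊗[k] X := (TensorProduct.mk k P X).flip x

@[simp] theorem append_apply (x : X) (a : P) : append (k := k) x a = a ⊗ₜ x := rfl

theorem append_induction_one {p : M ⊗[k] X → Prop}
    (h0 : p 0) (ha : ∀ z w, p z → p w → p (z + w))
    (ht : ∀ x a, p (append x a)) (z : M ⊗[k] X) : p z := by
  induction z with
  | zero => exact h0
  | add z w hz hw => exact ha z w hz hw
  | tmul a x => exact ht x a

theorem append_induction_two {p : M ⊗[k] (N ⊗[k] X) → Prop}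
    (h0 : p 0) (ha : ∀ z w, p z → p w → p (z + w))
    (ht : ∀ x t, p (lTensor M (append x) t)) (z : M ⊗[k] (N ⊗[k] X)) : p z := by
  induction z using induction_two with
  | h0 => exact h0
  | ha z w hz hw => exact ha z w hz hw
  | ht a b x => exact ht x (a ⊗ₜ b)

theorem append_induction_three {p : M ⊗[k] (N ⊗[k] (P ⊗[k] X)) → Prop}
    (h0 : p 0) (ha : ∀ z w, p z → p w → p (z + w))
    (ht : ∀ x t, p (lTensor M (lTensor N (append x)) t))
    (z : M ⊗[k] (N ⊗[k] (P ⊗[k] X))) : p z := by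
  induction z with
  | zero => exact h0
  | add z w hz hw => exact ha z w hz hw
  | tmul a y =>
    induction y using append_induction_two with
    | h0 => simpa using h0
    | ha z w hz hw => rw [tmul_add]; exact ha _ _ hz hw
    | ht x t => exact ht x (a ⊗ₜ t)

theorem append_induction_four {p : M ⊗[k] (N ⊗[k] (P ⊗[k] (Q ⊗[k] X))) → Prop}
    (h0 : p 0) (ha : ∀ z w, p z → p w → p (z + w))
    (ht : ∀ x t, p (lTensor M (lTensor N (lTensor P (append x))) t))
    (z : M ⊗[k] (N ⊗[k] (P ⊗[k] (Q ⊗[k] X)))) : p z := by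
  induction z with
  | zero => exact h0
  | add z w hz hw => exact ha z w hz hw
  | tmul a y =>
    induction y using append_induction_three with
    | h0 => simpa using h0
    | ha z w hz hw => rw [tmul_add]; exact ha _ _ hz hw
    | ht x t => exact ht x (a ⊗ₜ t)

theorem head11_append (f : M →ₗ[k] P) (x : X) (a : M) :
    head11 f (append x a) = append x (f a) := by simp

theorem head12_append (f : M →ₗ[k] P ⊗[k] Q) (x : X) (a : M) :
    head12 f (append x a) = lTensor P (append x) (f a) := by
  simp only [append_apply, head12_tmul]
  induction f a with
  | zero => simp
  | add z w hz hw => simp [add_tmul, hz, hw]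
  | tmul a x => simp

theorem head21_append (f : M ⊗[k] N →ₗ[k] P) (x : X) (t : M ⊗[k] N) :
    head21 f (lTensor M (append x) t) = append x (f t) := by
  induction t with
  | zero => simp
  | add z w hz hw => simp only [map_add, hz, hw]
  | tmul a x => simp

theorem head22_append (f : M ⊗[k] N →ₗ[k] P ⊗[k] Q) (x : X) (t : M ⊗[k] N) :
    head22 f (lTensor M (append x) t) = lTensor P (append x) (f t) := by
  induction t with
  | zero => simp
  | add z w hz hw => simp only [map_add, hz, hw]
  | tmul a b => simpa using head12_append f x (a ⊗ₜ b)

theorem lTensor_head10_append (f : N →ₗ[k] k) (x : X) (t : M ⊗[k] N) :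
    lTensor M (head10 f) (lTensor M (append x) t) =
      append x (TensorProduct.rid k M (lTensor M f t)) := by
  induction t with
  | zero => simp
  | add z w hz hw => simp only [map_add, hz, hw]
  | tmul a b => simp

theorem lTensor_congr {f g : X →ₗ[k] Y} (h : ∀ z, f z = g z) (z : M ⊗[k] X) :
    lTensor M f z = lTensor M g z := by
  rw [LinearMap.ext h]

section Lift

variable {X₁ X₂ Y₁ Y₂ : Type*} [AddCommMonoid X₁] [Module k X₁] [AddCommMonoid X₂] [Module k X₂]
  [AddCommMonoid Y₁] [Module k Y₁] [AddCommMonoid Y₂] [Module k Y₂]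

theorem lift20 {g : X →ₗ[k] X₁} {f : X₁ →ₗ[k] X} (h : ∀ z, f (g z) = z) (z : M ⊗[k] X) :
    lTensor M f (lTensor M g z) = z := by
  rw [← lTensor_comp_apply, LinearMap.ext (f := f ∘ₗ g) (g := LinearMap.id) h]; simp

theorem lift21 {g : X →ₗ[k] X₁} {f : X₁ →ₗ[k] Y} {f' : X →ₗ[k] Y}
    (h : ∀ z, f (g z) = f' z) (z : M ⊗[k] X) :
    lTensor M f (lTensor M g z) = lTensor M f' z := by
  rw [← lTensor_comp_apply]; exact lTensor_congr h z

theorem lift22 {g : X →ₗ[k] X₁} {f : X₁ →ₗ[k] Y} {g' : X →ₗ[k] Y₁} {f' : Y₁ →ₗ[k] Y}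
    (h : ∀ z, f (g z) = f' (g' z)) (z : M ⊗[k] X) :
    lTensor M f (lTensor M g z) = lTensor M f' (lTensor M g' z) := by
  simp only [← lTensor_comp_apply]; exact lTensor_congr h z

theorem lift23 {g : X →ₗ[k] X₁} {f : X₁ →ₗ[k] Y} {e' : X →ₗ[k] Y₁} {g' : Y₁ →ₗ[k] Y₂}
    {f' : Y₂ →ₗ[k] Y} (h : ∀ z, f (g z) = f' (g' (e' z))) (z : M ⊗[k] X) :
    lTensor M f (lTensor M g z) = lTensor M f' (lTensor M g' (lTensor M e' z)) := by
  simp only [← lTensor_comp_apply]; exact lTensor_congr h z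

end Lift

end Head

/-! ### The axioms of a braided module algebra acting on leading factors -/

section Axioms

variable {X : Type*} [AddCommMonoid X] [Module k X]

local notation "ε₀" => head10 (Coalgebra.counit (R := k) (A := H))
local notation "Δ₀" => head12 (Coalgebra.comul (R := k) (A := H))
local notation "μ₀" => head21 (LinearMap.mul' k H)
local notation "m₀" => head21 (LinearMap.mul' k A)
local notation "L" => LinearMap.lTensor _

theorem comul_comul (z : H ⊗[k] X) : Δ₀ (Δ₀ z) = L Δ₀ (Δ₀ z) := by
  induction z using append_induction_one with
  | h0 => simp only [map_zero]
  | ha z w hz hw => simp only [map_add, hz, hw]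
  | ht x t =>
    simp only [head12_append, lift22 (head12_append (Coalgebra.comul (R := k) (A := H)) x),
      head12_lTensor]
    congr 1
    exact LinearMap.congr_fun (Coalgebra.coassoc (R := k) (A := H)) t

theorem counit_comul (z : H ⊗[k] X) : ε₀ (Δ₀ z) = z := by
  induction z using append_induction_one with
  | h0 => simp only [map_zero]
  | ha z w hz hw => simp only [map_add, hz, hw]
  | ht x t =>
    simp only [head12_append, head10_lTensor]
    congr 1
    simp [head10]

theorem lTensor_counit_comul (z : H ⊗[k] X) : L ε₀ (Δ₀ z) = z := by
  induction z using append_induction_one with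
  | h0 => simp only [map_zero]
  | ha z w hz hw => simp only [map_add, hz, hw]
  | ht x t =>
    simp only [head12_append, lTensor_head10_append]
    congr 1
    simp

theorem counit_mul (D : ModAlgData k H A) (z : H ⊗[k] (H ⊗[k] X)) : ε₀ (μ₀ z) = ε₀ (ε₀ z) := by
  induction z using induction_two with
  | h0 => simp only [map_zero]
  | ha z w hz hw => simp only [map_add, hz, hw]
  | ht a b x => simp [D.counit_mul, mul_smul]

theorem braid_braid (hcc : D.Cocomm) (z : H ⊗[k] (H ⊗[k] X)) :
    head22 D.c (head22 D.c z) = z := by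
  induction z using append_induction_two with
  | h0 => simp only [map_zero]
  | ha z w hz hw => simp only [map_add, hz, hw]
  | ht x t =>
    simp only [head22_append]
    congr 1
    exact LinearMap.congr_fun hcc.1 t

theorem braid_comul (hcc : D.Cocomm) (z : H ⊗[k] X) : head22 D.c (Δ₀ z) = Δ₀ z := by
  induction z using append_induction_one with
  | h0 => simp only [map_zero]
  | ha z w hz hw => simp only [map_add, hz, hw]
  | ht x t =>
    simp only [head12_append, head22_append]
    congr 1
    exact LinearMap.congr_fun hcc.2 t

theorem braid_mul_right (z : H ⊗[k] (H ⊗[k] (H ⊗[k] X))) :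
    head22 D.c (L μ₀ z) = μ₀ (L (head22 D.c) (head22 D.c z)) := by
  induction z using append_induction_three with
  | h0 => simp only [map_zero]
  | ha z w hz hw => simp only [map_add, hz, hw]
  | ht x t =>
    simp only [lift22 (head21_append (LinearMap.mul' k H) x), head22_append, head22_lTensor,
      lift22 (head22_append D.c x), head21_lTensor]
    congr 1
    exact LinearMap.congr_fun D.c_mul_right t

theorem lTensor_comul_braid (z : H ⊗[k] (H ⊗[k] X)) :
    L Δ₀ (head22 D.c z) = head22 D.c (L (head22 D.c) (Δ₀ z)) := by
  induction z using append_induction_two with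
  | h0 => simp only [map_zero]
  | ha z w hz hw => simp only [map_add, hz, hw]
  | ht x t =>
    simp only [lift22 (head12_append (Coalgebra.comul (R := k) (A := H)) x), head22_append,
      head22_lTensor, lift22 (head22_append D.c x), head12_lTensor]
    congr 1
    exact LinearMap.congr_fun D.c_comul_left t

theorem comul_braid (z : H ⊗[k] (H ⊗[k] X)) :
    Δ₀ (head22 D.c z) = L (head22 D.c) (head22 D.c (L Δ₀ z)) := by
  induction z using append_induction_two with
  | h0 => simp only [map_zero]
  | ha z w hz hw => simp only [map_add, hz, hw]
  | ht x t =>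
    simp only [lift22 (head12_append (Coalgebra.comul (R := k) (A := H)) x), head22_append,
      head22_lTensor, lift22 (head22_append D.c x), head12_lTensor]
    congr 1
    have := LinearMap.congr_fun D.c_comul_right t
    exact (LinearEquiv.eq_symm_apply _).1 this

theorem lTensor_counit_braid (z : H ⊗[k] (H ⊗[k] X)) : L ε₀ (head22 D.c z) = ε₀ z := by
  induction z using append_induction_two with
  | h0 => simp only [map_zero]
  | ha z w hz hw => simp only [map_add, hz, hw]
  | ht x t =>
    simp only [head22_append, lTensor_head10_append, head10_lTensor]
    congr 1
    exact LinearMap.congr_fun D.c_counit_left t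

theorem counit_braid (z : H ⊗[k] (H ⊗[k] X)) : ε₀ (head22 D.c z) = L ε₀ z := by
  induction z using append_induction_two with
  | h0 => simp only [map_zero]
  | ha z w hz hw => simp only [map_add, hz, hw]
  | ht x t =>
    simp only [head22_append, lTensor_head10_append, head10_lTensor]
    congr 1
    exact LinearMap.congr_fun D.c_counit_right t

theorem lTensor_counit_transposition (z : H ⊗[k] (A ⊗[k] X)) : L ε₀ (head22 D.s z) = ε₀ z := by
  induction z using append_induction_two with
  | h0 => simp only [map_zero]
  | ha z w hz hw => simp only [map_add, hz, hw]
  | ht x t =>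
    simp only [head22_append, lTensor_head10_append, head10_lTensor]
    congr 1
    exact LinearMap.congr_fun D.s_counit t

theorem lTensor_comul_transposition (z : H ⊗[k] (A ⊗[k] X)) :
    L Δ₀ (head22 D.s z) = head22 D.s (L (head22 D.s) (Δ₀ z)) := by
  induction z using append_induction_two with
  | h0 => simp only [map_zero]
  | ha z w hz hw => simp only [map_add, hz, hw]
  | ht x t =>
    simp only [lift22 (head12_append (Coalgebra.comul (R := k) (A := H)) x), head22_append,
      head22_lTensor, lift22 (head22_append D.s x), head12_lTensor]
    congr 1
    exact LinearMap.congr_fun D.s_comul t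

theorem transposition_mul (z : H ⊗[k] (A ⊗[k] (A ⊗[k] X))) :
    head22 D.s (L m₀ z) = m₀ (L (head22 D.s) (head22 D.s z)) := by
  induction z using append_induction_three with
  | h0 => simp only [map_zero]
  | ha z w hz hw => simp only [map_add, hz, hw]
  | ht x t =>
    simp only [lift22 (head21_append (LinearMap.mul' k A) x), head22_append, head22_lTensor,
      lift22 (head22_append D.s x), head21_lTensor]
    congr 1
    exact LinearMap.congr_fun D.s_mul_A t

theorem transposition_action (z : H ⊗[k] (H ⊗[k] (A ⊗[k] X))) :
    head22 D.s (L (head21 D.ρ) z) = head21 D.ρ (L (head22 D.s) (head22 D.c z)) := by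
  induction z using append_induction_three with
  | h0 => simp only [map_zero]
  | ha z w hz hw => simp only [map_add, hz, hw]
  | ht x t =>
    simp only [lift22 (head21_append D.ρ x), head22_append, head22_lTensor,
      lift22 (head22_append D.s x), head21_lTensor]
    congr 1
    exact LinearMap.congr_fun D.s_ρ t

theorem action_mul (z : H ⊗[k] (H ⊗[k] (A ⊗[k] X))) :
    head21 D.ρ (μ₀ z) = head21 D.ρ (L (head21 D.ρ) z) := by
  induction z using append_induction_three with
  | h0 => simp only [map_zero]
  | ha z w hz hw => simp only [map_add, hz, hw]
  | ht x t =>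
    simp only [lift22 (head21_append D.ρ x), head21_append, head21_lTensor]
    congr 1
    exact (LinearMap.congr_fun D.ρ_mul ((TensorProduct.assoc k H H A).symm t)).trans (by simp)

theorem mul_mul (z : A ⊗[k] (A ⊗[k] (A ⊗[k] X))) : m₀ (m₀ z) = m₀ (L m₀ z) := by
  induction z with
  | zero => simp only [map_zero]
  | add z w hz hw => simp only [map_add, hz, hw]
  | tmul a y =>
    induction y using induction_two with
    | h0 => simp
    | ha z w hz hw => simp only [tmul_add, map_add, hz, hw]
    | ht b c x => simp [mul_assoc]

theorem action_mul_right (z : H ⊗[k] (A ⊗[k] (A ⊗[k] X))) :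
    head21 D.ρ (L m₀ z) =
      m₀ (head21 D.ρ (L (L (head21 D.ρ)) (L (head22 D.s) (Δ₀ z)))) := by
  induction z using append_induction_three with
  | h0 => simp only [map_zero]
  | ha z w hz hw => simp only [map_add, hz, hw]
  | ht x t =>
    simp only [lift22 (head21_append (LinearMap.mul' k A) x), head21_append, head12_lTensor,
      lift22 (head22_lTensor D.s (append x)), lift22 (lift22 (head21_append D.ρ x)),
      head21_lTensor]
    congr 1
    refine (LinearMap.congr_fun D.ρ_mul_A t).trans ?_
    exact congrArg (LinearMap.mul' k A)
      (LinearMap.congr_fun (lTensor_comp_rTensor (f := D.ρ) (g := D.ρ)) _).symm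


/-- The comultiplication of `H ⊗ H` acting on the first two factors. -/
def headComul2 : H ⊗[k] (H ⊗[k] X) →ₗ[k] H ⊗[k] (H ⊗[k] (H ⊗[k] (H ⊗[k] X))) :=
  L (head22 D.c) ∘ₗ Δ₀ ∘ₗ L Δ₀

theorem headComul2_apply (z : H ⊗[k] (H ⊗[k] X)) :
    headComul2 D z = L (head22 D.c) (Δ₀ (L Δ₀ z)) := rfl

theorem headComul2_lTensor {Y : Type*} [AddCommMonoid Y] [Module k Y] (φ : X →ₗ[k] Y)
    (z : H ⊗[k] (H ⊗[k] X)) :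
    headComul2 D (L (L φ) z) = L (L (L (L φ))) (headComul2 D z) := by
  simp only [headComul2_apply, lift22 (head12_lTensor _ φ), head12_lTensor,
    lift22 (head22_lTensor D.c _)]

theorem headComul2_append (x : X) (t : H ⊗[k] H) :
    headComul2 D (L (append x) t) =
      L (L (L (append x))) (TensorProduct.assoc k H H (H ⊗[k] H) (D.comul2 t)) := by
  simp only [headComul2_apply, lift22 (head12_append (Coalgebra.comul (R := k) (A := H)) x),
    head12_lTensor, lift22 (head22_lTensor D.c _)]
  congr 1
  simp only [ModAlgData.comul2, LinearMap.comp_apply, LinearEquiv.coe_coe,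
    LinearEquiv.apply_symm_apply]
  rw [← rTensor_comp_lTensor, ← head12_lTensor]
  rfl

theorem map_headComul2_append {M N : Type*} [AddCommMonoid M] [Module k M]
    [AddCommMonoid N] [Module k N] (p : H ⊗[k] H →ₗ[k] M) (q : H ⊗[k] H →ₗ[k] N)
    (x : X) (t : H ⊗[k] H) :
    head21 p (L (L (head21 q)) (headComul2 D (L (append x) t)))
      = L (append x) (TensorProduct.map p q (D.comul2 t)) := by
  simp only [headComul2_append]
  generalize D.comul2 t = w
  induction w with
  | zero => simp
  | add z w hz hw => simp only [map_add, hz, hw]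
  | tmul a b =>
    induction a with
    | zero => simp
    | add z w hz hw => simp only [map_add, add_tmul, hz, hw]
    | tmul a a' =>
      simp only [TensorProduct.assoc_tmul, lTensor_tmul, TensorProduct.map_tmul, head21_append,
        head21_tmul]

theorem head21_conv2 (p q : H ⊗[k] H →ₗ[k] A) (z : H ⊗[k] (H ⊗[k] X)) :
    head21 (conv2 D p q) z = m₀ (head21 p (L (L (head21 q)) (headComul2 D z))) := by
  induction z using append_induction_two with
  | h0 => simp only [map_zero]
  | ha z w hz hw => simp only [map_add, hz, hw]
  | ht x t =>
    rw [map_headComul2_append, head21_append, head21_append]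
    rfl

theorem head22_Ffmap (p : H ⊗[k] H →ₗ[k] A) (z : H ⊗[k] (H ⊗[k] X)) :
    head22 (Ffmap D p) z = head21 p (L (L μ₀) (headComul2 D z)) := by
  induction z using append_induction_two with
  | h0 => simp only [map_zero]
  | ha z w hz hw => simp only [map_add, hz, hw]
  | ht x t =>
    rw [map_headComul2_append, head22_append]
    rfl

theorem headComul2_headComul2 (z : H ⊗[k] (H ⊗[k] X)) :
    headComul2 D (headComul2 D z) = L (L (headComul2 D)) (headComul2 D z) := by
  simp only [headComul2, LinearMap.comp_apply, lTensor_comp]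
  rw [lift23 (comul_braid D), head12_lTensor _ (lTensor _ (head22 D.c)),
    head12_lTensor _ (head22 D.c), ← head12_lTensor _ Δ₀,
    ← lift22 (head22_lTensor D.c Δ₀), lift23 (lTensor_comul_braid D),
    ← head12_lTensor _ (lTensor _ Δ₀), ← comul_comul, ← lift22 comul_comul,
    ← lift22 (head22_lTensor D.c (head22 D.c))]

theorem comul_mul (z : H ⊗[k] (H ⊗[k] X)) :
    Δ₀ (μ₀ z) = μ₀ (L (L μ₀) (headComul2 D z)) := by
  induction z using append_induction_two with
  | h0 => simp only [map_zero]
  | ha z w hz hw => simp only [map_add, hz, hw]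
  | ht x t =>
    rw [map_headComul2_append, head21_append, head12_append]
    congr 1
    exact LinearMap.congr_fun D.comul_mul t

theorem braid_headComul2 (hcc : D.Cocomm) (z : H ⊗[k] (H ⊗[k] X)) :
    L (head22 D.c) (head22 D.c (L (L (head22 D.c)) (L (head22 D.c) (headComul2 D z)))) =
      headComul2 D z := by
  simp only [headComul2_apply, lift20 (braid_braid D hcc)]
  rw [← head12_lTensor, lift21 (braid_comul D hcc), braid_comul D hcc]

end Axioms

/-! ### Units, counits and convolution -/

section Units

variable {X : Type*} [AddCommMonoid X] [Module k X]

local notation "ε₀" => head10 (Coalgebra.counit (R := k) (A := H))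
local notation "Δ₀" => head12 (Coalgebra.comul (R := k) (A := H))
local notation "μ₀" => head21 (LinearMap.mul' k H)
local notation "m₀" => head21 (LinearMap.mul' k A)
local notation "L" => LinearMap.lTensor _
local notation "ηH" => TensorProduct.mk k H _ 1
local notation "ηA" => TensorProduct.mk k A _ 1

theorem lTensor_mk {M Y : Type*} [AddCommMonoid M] [Module k M] [AddCommMonoid Y] [Module k Y]
    (a : M) (φ : X →ₗ[k] Y) (x : X) :
    lTensor M φ (TensorProduct.mk k M X a x) = TensorProduct.mk k M Y a (φ x) := by simp

theorem head21_mul'_mk_one {B : Type*} [Ring B] [Algebra k B] (z : B ⊗[k] X) :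
    head21 (LinearMap.mul' k B) (TensorProduct.mk k B _ 1 z) = z := by
  induction z with
  | zero => simp
  | add z w hz hw => simp only [map_add, hz, hw]
  | tmul a x => simp

theorem head21_mul'_lTensor_mk_one {B : Type*} [Ring B] [Algebra k B] (z : B ⊗[k] X) :
    head21 (LinearMap.mul' k B) (L (TensorProduct.mk k B _ 1) z) = z := by
  induction z with
  | zero => simp
  | add z w hz hw => simp only [map_add, hz, hw]
  | tmul a x => simp

theorem comul_mk_one (D : ModAlgData k H A) (x : X) : Δ₀ (ηH x) = ηH (ηH x) := by
  simp [D.comul_one]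

theorem braid_lTensor_mk_one (z : H ⊗[k] X) : head22 D.c (L ηH z) = ηH z := by
  induction z with
  | zero => simp
  | add z w hz hw => simp only [map_add, hz, hw]
  | tmul a x => simp [D.c_one_right]

theorem transposition_lTensor_mk_one (z : H ⊗[k] X) : head22 D.s (L ηA z) = ηA z := by
  induction z with
  | zero => simp
  | add z w hz hw => simp only [map_add, hz, hw]
  | tmul a x => simp [D.s_one_right]

theorem action_mk_one (z : A ⊗[k] X) : head21 D.ρ (ηH z) = z := by
  induction z with
  | zero => simp
  | add z w hz hw => simp only [map_add, hz, hw]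
  | tmul a x => simp [D.ρ_one]

theorem action_lTensor_mk_one (z : H ⊗[k] X) : head21 D.ρ (L ηA z) = ηA (ε₀ z) := by
  induction z with
  | zero => simp
  | add z w hz hw => simp only [map_add, hz, hw]
  | tmul a x => simp [D.ρ_unit, smul_tmul]

theorem mul_antipode_comul (z : H ⊗[k] X) :
    μ₀ (L (head11 D.antipode) (Δ₀ z)) = ηH (ε₀ z) := by
  induction z using append_induction_one with
  | h0 => simp only [map_zero]
  | ha z w hz hw => simp only [map_add, hz, hw]
  | ht x t =>
    simp only [head12_append, lift22 (head11_append D.antipode x), head21_append]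
    have := LinearMap.congr_fun D.antipode_right t
    simp only [LinearMap.comp_apply] at this
    simp [this, Algebra.algebraMap_eq_smul_one]

theorem head21_unit2 (z : H ⊗[k] (H ⊗[k] X)) :
    head21 (unit2 (k := k) (H := H) (A := A)) z = ηA (ε₀ (ε₀ z)) := by
  induction z using induction_two with
  | h0 => simp only [map_zero]
  | ha z w hz hw => simp only [map_add, hz, hw]
  | ht a b x => simp [unit2, Algebra.algebraMap_eq_smul_one, smul_tmul, mul_smul]

theorem head11_unit1 (z : H ⊗[k] X) :
    head11 (unit1 (k := k) (H := H) (A := A)) z = ηA (ε₀ z) := by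
  induction z with
  | zero => simp only [map_zero]
  | add z w hz hw => simp only [map_add, hz, hw]
  | tmul a x => simp [unit1, Algebra.algebraMap_eq_smul_one, smul_tmul]

theorem counit_counit_headComul2 (z : H ⊗[k] (H ⊗[k] X)) :
    ε₀ (ε₀ (headComul2 D z)) = z := by
  rw [headComul2_apply, head10_lTensor, counit_comul, counit_braid, lift20 counit_comul]

theorem lTensor_counit_counit_headComul2 (z : H ⊗[k] (H ⊗[k] X)) :
    L (L ε₀) (L (L ε₀) (headComul2 D z)) = z := by
  rw [headComul2_apply, lift21 (lTensor_counit_braid D), lTensor_counit_comul,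
    lift20 lTensor_counit_comul]

theorem conv2_assoc (p q r : H ⊗[k] H →ₗ[k] A) :
    conv2 D (conv2 D p q) r = conv2 D p (conv2 D q r) := by
  refine head21_injective fun z => ?_
  have h : head21 (X := k) (conv2 D q r) = m₀ ∘ₗ head21 q ∘ₗ L (L (head21 r)) ∘ₗ headComul2 D :=
    LinearMap.ext (head21_conv2 D q r)
  simp only [head21_conv2, h, lTensor_comp, LinearMap.comp_apply]
  rw [headComul2_lTensor, headComul2_headComul2, head21_lTensor, mul_mul]
  simp only [head21_lTensor]

theorem conv2_unit2 (p : H ⊗[k] H →ₗ[k] A) : conv2 D p unit2 = p := by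
  refine head21_injective fun z => ?_
  have h : head21 (X := k) (unit2 (k := k) (H := H) (A := A)) = ηA ∘ₗ ε₀ ∘ₗ ε₀ :=
    LinearMap.ext head21_unit2
  rw [head21_conv2, h]
  simp only [lTensor_comp, LinearMap.comp_apply]
  rw [lTensor_counit_counit_headComul2, head21_lTensor, head21_mul'_lTensor_mk_one]

theorem unit2_conv2 (p : H ⊗[k] H →ₗ[k] A) : conv2 D unit2 p = p := by
  refine head21_injective fun z => ?_
  rw [head21_conv2, head21_unit2, head21_mul'_mk_one, head10_lTensor, head10_lTensor,
    counit_counit_headComul2]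

theorem head11_conv1 (u v : H →ₗ[k] A) (z : H ⊗[k] X) :
    head11 (conv1 u v) z = m₀ (head11 u (L (head11 v) (Δ₀ z))) := by
  induction z using append_induction_one with
  | h0 => simp only [map_zero]
  | ha z w hz hw => simp only [map_add, hz, hw]
  | ht x t =>
    simp only [head12_append, lift22 (head11_append v x), head11_lTensor, head21_append,
      head11_append]
    congr 1
    exact congrArg (LinearMap.mul' k A)
      (LinearMap.congr_fun (lTensor_comp_rTensor (f := u) (g := v)) _).symm

theorem head21_d1₁ (u : H →ₗ[k] A) (z : H ⊗[k] (H ⊗[k] X)) :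
    head21 (d1₁ u) z = head11 u (μ₀ z) := by
  induction z using induction_two with
  | h0 => simp only [map_zero]
  | ha z w hz hw => simp only [map_add, hz, hw]
  | ht a b x => simp [d1₁]

theorem head21_d2₁ (u : H →ₗ[k] A) (z : H ⊗[k] (H ⊗[k] X)) :
    head21 (d2₁ u) z = head11 u (L ε₀ z) := by
  induction z using induction_two with
  | h0 => simp only [map_zero]
  | ha z w hz hw => simp only [map_add, hz, hw]
  | ht a b x => simp [d2₁, smul_tmul]

theorem head21_d0₁ (u : H →ₗ[k] A) (z : H ⊗[k] (H ⊗[k] X)) :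
    head21 (d0₁ D u) z = head21 D.ρ (L (head11 u) z) := by
  induction z using induction_two with
  | h0 => simp only [map_zero]
  | ha z w hz hw => simp only [map_add, hz, hw]
  | ht a b x => simp [d0₁]

theorem d1₁_conv1 (u v : H →ₗ[k] A) : d1₁ (conv1 u v) = conv2 D (d1₁ u) (d1₁ v) := by
  refine head21_injective fun z => ?_
  have h : head21 (X := k) (d1₁ v) = head11 v ∘ₗ μ₀ := LinearMap.ext (head21_d1₁ v)
  rw [head21_conv2, head21_d1₁, head21_d1₁, head11_conv1, comul_mul D, h]
  simp only [lTensor_comp, LinearMap.comp_apply, head21_lTensor]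

theorem d1₁_unit1 (D : ModAlgData k H A) : d1₁ (unit1 (k := k) (H := H) (A := A)) = unit2 := by
  refine head21_injective fun z => ?_
  rw [head21_d1₁, head11_unit1, counit_mul D, head21_unit2]

/-- The head form of compatibility with `s`. -/
theorem transposition_compatible {u : H →ₗ[k] A}
    (hu : D.s ∘ₗ lTensor H u = rTensor H u ∘ₗ D.c) (z : H ⊗[k] (H ⊗[k] X)) :
    head22 D.s (L (head11 u) z) = head11 u (head22 D.c z) := by
  induction z using append_induction_two with
  | h0 => simp only [map_zero]
  | ha z w hz hw => simp only [map_add, hz, hw]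
  | ht x t =>
    simp only [lift22 (head11_append u x), head22_append, head11_lTensor]
    congr 1
    exact LinearMap.congr_fun hu t

theorem mul_central {u : H →ₗ[k] A}
    (hu : LinearMap.mul' k A ∘ₗ lTensor A u ∘ₗ D.s = LinearMap.mul' k A ∘ₗ rTensor A u)
    (z : H ⊗[k] (A ⊗[k] X)) : m₀ (L (head11 u) (head22 D.s z)) = m₀ (head11 u z) := by
  induction z using append_induction_two with
  | h0 => simp only [map_zero]
  | ha z w hz hw => simp only [map_add, hz, hw]
  | ht x t =>
    simp only [lift22 (head11_append u x), head22_append, head11_lTensor, head21_append]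
    congr 1
    exact LinearMap.congr_fun hu t

theorem central_of_head {u : H →ₗ[k] A}
    (hu : ∀ z : H ⊗[k] (A ⊗[k] k), m₀ (L (head11 u) (head22 D.s z)) = m₀ (head11 u z)) :
    LinearMap.mul' k A ∘ₗ lTensor A u ∘ₗ D.s = LinearMap.mul' k A ∘ₗ rTensor A u := by
  refine LinearMap.ext fun t => ?_
  have := hu (L (append 1) t)
  simp only [lift22 (head11_append u (1 : k)), head22_append, head11_lTensor,
    head21_append] at this
  exact (TensorProduct.rid k A).symm.injective this

theorem mul_central_two {p : H ⊗[k] H →ₗ[k] A}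
    (hp : LinearMap.mul' k A ∘ₗ lTensor A p ∘ₗ D.s2 = LinearMap.mul' k A ∘ₗ rTensor A p)
    (z : H ⊗[k] (H ⊗[k] (A ⊗[k] X))) :
    m₀ (L (head21 p) (head22 D.s (L (head22 D.s) z))) = m₀ (head21 p z) := by
  induction z using append_induction_three with
  | h0 => simp only [map_zero]
  | ha z w hz hw => simp only [map_add, hz, hw]
  | ht x t =>
    simp only [lift22 (head22_append D.s x), head22_lTensor, lift22 (head21_append p x),
      head21_lTensor, head21_append]
    congr 1
    have := LinearMap.congr_fun hp ((TensorProduct.assoc k H H A).symm t)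
    simp only [ModAlgData.s2, LinearMap.comp_apply, LinearEquiv.coe_coe,
      LinearEquiv.apply_symm_apply] at this
    exact this

/-- A central map commutes with every `δ¹(u)`, for `u` compatible with `s`. -/
theorem conv2_d1₁_comm (hcc : D.Cocomm) {u : H →ₗ[k] A}
    (hu : D.s ∘ₗ lTensor H u = rTensor H u ∘ₗ D.c) {p : H ⊗[k] H →ₗ[k] A}
    (hp : ∀ z : H ⊗[k] (H ⊗[k] (A ⊗[k] k)),
      m₀ (L (head21 p) (head22 D.s (L (head22 D.s) z))) = m₀ (head21 p z)) :
    conv2 D p (d1₁ u) = conv2 D (d1₁ u) p := by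
  refine head21_injective fun z => ?_
  have h : head21 (X := k) (d1₁ u) = head11 u ∘ₗ μ₀ := LinearMap.ext (head21_d1₁ u)
  rw [head21_conv2, head21_conv2, h, head21_d1₁]
  simp only [lTensor_comp, LinearMap.comp_apply]
  rw [← hp, lift22 (transposition_compatible D hu), transposition_compatible D hu,
    lift23 (braid_mul_right D), braid_mul_right D, braid_headComul2 D hcc,
    head21_lTensor, ← head11_lTensor]

theorem d2₁_central {u : H →ₗ[k] A}
    (hu : LinearMap.mul' k A ∘ₗ lTensor A u ∘ₗ D.s = LinearMap.mul' k A ∘ₗ rTensor A u)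
    (z : H ⊗[k] (H ⊗[k] (A ⊗[k] X))) :
    m₀ (L (head21 (d2₁ u)) (head22 D.s (L (head22 D.s) z))) = m₀ (head21 (d2₁ u) z) := by
  have h : head21 (X := X) (d2₁ u) = head11 u ∘ₗ L ε₀ := LinearMap.ext (head21_d2₁ u)
  rw [h, head21_d2₁]
  simp only [lTensor_comp, LinearMap.comp_apply]
  rw [← head22_lTensor, lift21 (lTensor_counit_transposition D), mul_central D hu]

end Units

/-! ### Crossed products and comodule maps -/

section Crossed

variable {X : Type*} [AddCommMonoid X] [Module k X]

local notation "ε₀" => head10 (Coalgebra.counit (R := k) (A := H))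
local notation "Δ₀" => head12 (Coalgebra.comul (R := k) (A := H))
local notation "μ₀" => head21 (LinearMap.mul' k H)
local notation "m₀" => head21 (LinearMap.mul' k A)
local notation "L" => LinearMap.lTensor _
local notation "ηH" => TensorProduct.mk k H _ 1
local notation "ηA" => TensorProduct.mk k A _ 1

theorem head22_χ (z : H ⊗[k] (A ⊗[k] X)) :
    head22 D.χ z = head21 D.ρ (L (head22 D.s) (Δ₀ z)) := by
  induction z using append_induction_two with
  | h0 => simp only [map_zero]
  | ha z w hz hw => simp only [map_add, hz, hw]
  | ht x t =>
    simp only [head12_lTensor, lift22 (head22_append D.s x), head21_lTensor, head22_append]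
    congr 1

/-- The left `A`-linear, right `H`-colinear map `a ⊗ h ↦ a u(h₁) ⊗ h₂`. -/
def comoduleMap (u : H →ₗ[k] A) : A ⊗[k] H →ₗ[k] A ⊗[k] H :=
  m₀ ∘ₗ L (head11 u ∘ₗ Coalgebra.comul (R := k))

theorem head22_comoduleMap (u : H →ₗ[k] A) (z : A ⊗[k] (H ⊗[k] X)) :
    head22 (comoduleMap u) z = m₀ (L (head11 u) (L Δ₀ z)) := by
  induction z using append_induction_two with
  | h0 => simp only [map_zero]
  | ha z w hz hw => simp only [map_add, hz, hw]
  | ht x t =>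
    simp only [lift22 (head12_append (Coalgebra.comul (R := k) (A := H)) x),
      lift22 (head11_lTensor u (append x)), head21_lTensor, head22_append]
    congr 1
    simp only [comoduleMap, lTensor_comp, LinearMap.comp_apply]

/-- The product `(h, b ⊗ l) ↦ (1 ⊗ h)(b ⊗ l)` of the crossed product. -/
def headAct (f : H ⊗[k] H →ₗ[k] A) : H ⊗[k] (A ⊗[k] (H ⊗[k] X)) →ₗ[k] A ⊗[k] (H ⊗[k] X) :=
  m₀ ∘ₗ L (head22 (Ffmap D f)) ∘ₗ head22 D.χ

theorem headAct_apply (f : H ⊗[k] H →ₗ[k] A) (z : H ⊗[k] (A ⊗[k] (H ⊗[k] X))) :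
    headAct D f z = m₀ (L (head22 (Ffmap D f)) (head22 D.χ z)) := rfl

/-- The multiplication of the crossed product acting on leading factors. -/
def headCrossedMul (f : H ⊗[k] H →ₗ[k] A) :
    A ⊗[k] (H ⊗[k] (A ⊗[k] (H ⊗[k] X))) →ₗ[k] A ⊗[k] (H ⊗[k] X) :=
  m₀ ∘ₗ L (headAct D f)

theorem headCrossedMul_apply (f : H ⊗[k] H →ₗ[k] A)
    (z : A ⊗[k] (H ⊗[k] (A ⊗[k] (H ⊗[k] X)))) :
    headCrossedMul D f z = m₀ (L (headAct D f) z) := rfl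

theorem map_assoc_symm {M N P Q E : Type*} [AddCommMonoid M] [Module k M]
    [AddCommMonoid N] [Module k N] [AddCommMonoid P] [Module k P] [AddCommMonoid Q] [Module k Q]
    [AddCommMonoid E] [Module k E] (f : M ⊗[k] N →ₗ[k] P) (g : Q →ₗ[k] E)
    (w : M ⊗[k] (N ⊗[k] Q)) :
    TensorProduct.map f g ((TensorProduct.assoc k M N Q).symm w) = head21 f (L (L g) w) := by
  induction w using induction_two with
  | h0 => simp only [map_zero]
  | ha z w hz hw => simp only [map_add, hz, hw]
  | ht a b x => simp

theorem headCrossedMul_append (f : H ⊗[k] H →ₗ[k] A) (x : X)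
    (t : A ⊗[k] (H ⊗[k] (A ⊗[k] H))) :
    headCrossedMul D f (L (L (L (append x))) t) =
      L (append x) (crossedMul D f ((TensorProduct.assoc k A H (A ⊗[k] H)).symm t)) := by
  rw [headCrossedMul_apply]
  simp only [headAct, lTensor_comp, LinearMap.comp_apply, lift22 (head22_lTensor D.χ _),
    lift22 (lift22 (head22_append (Ffmap D f) x)), lift22 (head21_lTensor _ (append x)),
    head21_lTensor]
  congr 1
  rw [← mul_mul, ← map_assoc_symm]
  simp only [crossedMul, LinearMap.comp_apply, LinearEquiv.coe_coe,
    LinearEquiv.apply_symm_apply]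
  rfl

theorem comoduleMap_mul (u : H →ₗ[k] A) (z : A ⊗[k] (A ⊗[k] (H ⊗[k] X))) :
    head22 (comoduleMap u) (m₀ z) = m₀ (L (head22 (comoduleMap u)) z) := by
  have h : head22 (X := X) (comoduleMap u) = m₀ ∘ₗ L (head11 u) ∘ₗ L Δ₀ :=
    LinearMap.ext (head22_comoduleMap u)
  rw [h]
  simp only [lTensor_comp, LinearMap.comp_apply]
  rw [← head21_lTensor, ← head21_lTensor, mul_mul]

/-- Multiplicativity of a comodule map in terms of leading factors. -/
theorem crossedMul_comp_iff (f f' : H ⊗[k] H →ₗ[k] A) (g : A ⊗[k] H →ₗ[k] A ⊗[k] H) :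
    g ∘ₗ crossedMul D f = crossedMul D f' ∘ₗ TensorProduct.map g g ↔
      ∀ z : A ⊗[k] (H ⊗[k] (A ⊗[k] (H ⊗[k] k))), head22 g (headCrossedMul D f z) =
        headCrossedMul D f' (head22 g (L (L (head22 g)) z)) := by
  have key : ∀ (x : k) (t : A ⊗[k] (H ⊗[k] (A ⊗[k] H))),
      headCrossedMul D f' (head22 g (L (L (head22 g)) (L (L (L (append x))) t))) =
      L (append x) (crossedMul D f' (TensorProduct.map g g
        ((TensorProduct.assoc k A H (A ⊗[k] H)).symm t))) := by
    intro x t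
    rw [lift22 (lift22 (head22_append g x)), head22_lTensor, headCrossedMul_append]
    congr 2
    rw [← rTensor_comp_lTensor]
    have h : lTensor (A ⊗[k] H) g ((TensorProduct.assoc k A H (A ⊗[k] H)).symm t) =
        (TensorProduct.assoc k A H (A ⊗[k] H)).symm (L (L g) t) := by
      induction t using induction_two with
      | h0 => simp only [map_zero]
      | ha z w hz hw => simp only [map_add, hz, hw]
      | ht a b x => simp
    rw [LinearMap.comp_apply, h]
    simp [head22]
  constructor
  · intro hg z
    induction z using append_induction_four with
    | h0 => simp only [map_zero]
    | ha z w hz hw => simp only [map_add, hz, hw]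
    | ht x t =>
      rw [key, headCrossedMul_append, head22_append]
      congr 1
      exact LinearMap.congr_fun hg _
  · intro hg
    refine LinearMap.ext fun t => ?_
    have h := hg (L (L (L (append 1))) (TensorProduct.assoc k A H (A ⊗[k] H) t))
    rw [key, headCrossedMul_append, head22_append, LinearEquiv.symm_apply_apply] at h
    exact (LinearEquiv.lTensor A (TensorProduct.rid k H).symm).injective h

theorem head22_Ffmap_conv2 (p q : H ⊗[k] H →ₗ[k] A) (z : H ⊗[k] (H ⊗[k] X)) :
    head22 (Ffmap D (conv2 D p q)) z =
      m₀ (head21 p (L (L (head22 (Ffmap D q))) (headComul2 D z))) := by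
  have h : head22 (X := X) (Ffmap D q) = head21 q ∘ₗ L (L μ₀) ∘ₗ headComul2 D :=
    LinearMap.ext (head22_Ffmap D q)
  simp only [head22_Ffmap, head21_conv2, h, lTensor_comp, LinearMap.comp_apply]
  rw [headComul2_lTensor, headComul2_headComul2]

theorem lTensor_counit_Ffmap (p : H ⊗[k] H →ₗ[k] A) (z : H ⊗[k] (H ⊗[k] X)) :
    L ε₀ (head22 (Ffmap D p) z) = head21 p z := by
  rw [head22_Ffmap, ← head21_lTensor, lift22 (lift22 (counit_mul D))]
  simp only [← lTensor_comp_apply]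
  simp only [lTensor_comp, LinearMap.comp_apply]
  rw [lTensor_counit_counit_headComul2]

theorem Ffmap_injective {p q : H ⊗[k] H →ₗ[k] A}
    (h : ∀ z : H ⊗[k] (H ⊗[k] k), head22 (Ffmap D p) z = head22 (Ffmap D q) z) : p = q :=
  head21_injective fun z => by
    rw [← lTensor_counit_Ffmap D p, h, lTensor_counit_Ffmap]

theorem χ_eq (hcc : D.Cocomm) (z : H ⊗[k] (A ⊗[k] X)) :
    head22 D.χ z = head22 D.s (L (head21 D.ρ) (Δ₀ z)) := by
  rw [head22_χ, transposition_action, braid_comul D hcc]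

theorem action_comul_surjective (z : H ⊗[k] (A ⊗[k] X)) :
    L (head21 D.ρ) (Δ₀ (L (head21 D.ρ) (L (head11 D.antipode) (Δ₀ z)))) = z := by
  have h (y : H ⊗[k] (A ⊗[k] X)) :
      head21 D.ρ (L (head21 D.ρ) (L (head11 D.antipode) (Δ₀ y))) = ε₀ y := by
    rw [← action_mul D, mul_antipode_comul, action_mk_one]
  rw [head12_lTensor, head12_lTensor, comul_comul]
  simp only [← lTensor_comp_apply]
  rw [lTensor_congr h, lTensor_counit_comul]

theorem lTensor_counit_χ (z : H ⊗[k] (A ⊗[k] X)) :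
    L ε₀ (head22 D.χ z) = head21 D.ρ z := by
  rw [head22_χ, ← head21_lTensor, lift21 (lTensor_counit_transposition D), lTensor_counit_comul]

theorem lTensor_comul_χ (z : H ⊗[k] (A ⊗[k] X)) :
    L Δ₀ (head22 D.χ z) = head22 D.χ (L (head22 D.s) (Δ₀ z)) := by
  rw [head22_χ, head22_χ, ← head21_lTensor, lift23 (lTensor_comul_transposition D),
    head12_lTensor, comul_comul]

theorem χ_mul (z : H ⊗[k] (A ⊗[k] (A ⊗[k] X))) :
    head22 D.χ (L m₀ z) = m₀ (L (head22 D.χ) (head22 D.χ z)) := by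
  have h : head22 (X := X) D.χ = head21 D.ρ ∘ₗ L (head22 D.s) ∘ₗ Δ₀ := LinearMap.ext (head22_χ D)
  simp only [h, lTensor_comp, LinearMap.comp_apply]
  rw [head12_lTensor, lift23 (transposition_mul D), action_mul_right D, head12_lTensor,
    head12_lTensor, lift22 (head22_lTensor D.s (head22 D.s)), head22_χ, ← head21_lTensor,
    ← head21_lTensor, ← head21_lTensor, lift23 (lTensor_comul_transposition D), comul_comul]

theorem χ_lTensor_mk_one (z : H ⊗[k] X) : head22 D.χ (L ηA z) = ηA z := by
  rw [head22_χ, head12_lTensor, lift21 (transposition_lTensor_mk_one D), action_lTensor_mk_one,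
    counit_comul]

theorem counit_comoduleMap (u : H →ₗ[k] A) (z : A ⊗[k] (H ⊗[k] X)) :
    L ε₀ (head22 (comoduleMap u) z) = m₀ (L (head11 u) z) := by
  rw [head22_comoduleMap, ← head21_lTensor, ← lift22 (head11_lTensor u ε₀),
    lift20 lTensor_counit_comul]

theorem comoduleMap_mk_one (u : H →ₗ[k] A) (z : H ⊗[k] X) :
    head22 (comoduleMap u) (ηA z) = head11 u (Δ₀ z) := by
  rw [head22_comoduleMap, lTensor_mk, lTensor_mk, head21_mul'_mk_one]

end Crossed

/-! ### Multiplicative comodule maps -/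

section Multiplicative

variable {X : Type*} [AddCommMonoid X] [Module k X]

local notation "ε₀" => head10 (Coalgebra.counit (R := k) (A := H))
local notation "Δ₀" => head12 (Coalgebra.comul (R := k) (A := H))
local notation "μ₀" => head21 (LinearMap.mul' k H)
local notation "m₀" => head21 (LinearMap.mul' k A)
local notation "L" => LinearMap.lTensor _
local notation "ηH" => TensorProduct.mk k H _ 1
local notation "ηA" => TensorProduct.mk k A _ 1

theorem head22_Ffmap_d1₁ (u : H →ₗ[k] A) (z : H ⊗[k] (H ⊗[k] X)) :
    head22 (Ffmap D (d1₁ u)) z = head11 u (Δ₀ (μ₀ z)) := by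
  rw [head22_Ffmap, head21_d1₁, comul_mul D]

theorem head22_Ffmap_d2₁_conv2 (u : H →ₗ[k] A) (p : H ⊗[k] H →ₗ[k] A)
    (z : H ⊗[k] (H ⊗[k] X)) :
    head22 (Ffmap D (conv2 D (d2₁ u) p)) z =
      m₀ (L (head22 (Ffmap D p)) (head11 u (Δ₀ z))) := by
  rw [head22_Ffmap_conv2, head21_d2₁, lift22 (head10_lTensor _ (head22 (Ffmap D p))),
    head11_lTensor, headComul2_apply, lift21 (counit_braid D), ← head12_lTensor,
    lift20 counit_comul]

theorem comoduleMap_Ffmap (u : H →ₗ[k] A) (f : H ⊗[k] H →ₗ[k] A)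
    (z : H ⊗[k] (H ⊗[k] X)) :
    head22 (comoduleMap u) (head22 (Ffmap D f) z) =
      head22 (Ffmap D (conv2 D f (d1₁ u))) z := by
  have h : head22 (X := X) (Ffmap D (d1₁ u)) = head11 u ∘ₗ Δ₀ ∘ₗ μ₀ :=
    LinearMap.ext (head22_Ffmap_d1₁ D u)
  rw [head22_Ffmap_conv2, head22_comoduleMap, head22_Ffmap, h]
  simp only [lTensor_comp, LinearMap.comp_apply, head21_lTensor]

theorem comoduleMap_headCrossedMul (u : H →ₗ[k] A) (f : H ⊗[k] H →ₗ[k] A)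
    (z : A ⊗[k] (H ⊗[k] (A ⊗[k] (H ⊗[k] X)))) :
    head22 (comoduleMap u) (headCrossedMul D f z) =
      headCrossedMul D (conv2 D f (d1₁ u)) z := by
  rw [headCrossedMul_apply, headCrossedMul_apply, comoduleMap_mul]
  congr 1
  refine lift21 (fun y => ?_) z
  rw [headAct_apply, headAct_apply, comoduleMap_mul, lift21 (comoduleMap_Ffmap D u f)]

/-- For central `u`, the comodule map of `u` intertwines the multiplication by `1 ⊗ h`. -/
theorem comoduleMap_χ (hcc : D.Cocomm) {u : H →ₗ[k] A}
    (hu : LinearMap.mul' k A ∘ₗ lTensor A u ∘ₗ D.s = LinearMap.mul' k A ∘ₗ rTensor A u)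
    (z : H ⊗[k] (A ⊗[k] X)) :
    head22 (comoduleMap u) (head22 D.χ z) = m₀ (head11 u (L (head22 D.χ) (Δ₀ z))) := by
  have h : head22 (X := X) D.χ = head21 D.ρ ∘ₗ L (head22 D.s) ∘ₗ Δ₀ := LinearMap.ext (head22_χ D)
  rw [head22_comoduleMap, lTensor_comul_χ, χ_eq D hcc, mul_central D hu, h]
  simp only [lTensor_comp, LinearMap.comp_apply]
  rw [head12_lTensor, comul_comul]

theorem χ_compatible {u : H →ₗ[k] A}
    (hc : D.s ∘ₗ lTensor H u = rTensor H u ∘ₗ D.c) (z : H ⊗[k] (H ⊗[k] X)) :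
    head22 D.χ (L (head11 u) (L Δ₀ z)) = head21 (d0₁ D u) (headComul2 D z) := by
  rw [head22_χ, head12_lTensor, lift22 (transposition_compatible D hc), head21_d0₁,
    headComul2_apply]

/-- The left hand factor in the comparison of the two multiplications. -/
theorem headAct_comoduleMap_comul (hcc : D.Cocomm) {u : H →ₗ[k] A}
    (hc : D.s ∘ₗ lTensor H u = rTensor H u ∘ₗ D.c)
    (hu : LinearMap.mul' k A ∘ₗ lTensor A u ∘ₗ D.s = LinearMap.mul' k A ∘ₗ rTensor A u)
    (p : H ⊗[k] H →ₗ[k] A) (z : H ⊗[k] (H ⊗[k] X)) :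
    m₀ (L (headAct D p) (head11 u (Δ₀ (L (head11 u) (L Δ₀ z))))) =
      head22 (Ffmap D (conv2 D (conv2 D (d0₁ D u) (d2₁ u)) p)) z := by
  have h : head22 (X := X) (Ffmap D (conv2 D (d2₁ u) p)) =
      m₀ ∘ₗ L (head22 (Ffmap D p)) ∘ₗ head11 u ∘ₗ Δ₀ :=
    LinearMap.ext (head22_Ffmap_d2₁_conv2 D u p)
  rw [conv2_assoc, head22_Ffmap_conv2, h]
  simp only [headAct, lTensor_comp, LinearMap.comp_apply]
  rw [← mul_mul, head21_lTensor, ← head11_lTensor, ← comoduleMap_χ D hcc hu,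
    χ_compatible D hc, head22_comoduleMap,
    ← head21_lTensor (LinearMap.mul' k A), mul_mul]
  simp only [head21_lTensor]

theorem headAct_comoduleMap (u : H →ₗ[k] A) (p : H ⊗[k] H →ₗ[k] A)
    (z : H ⊗[k] (A ⊗[k] (H ⊗[k] X))) :
    headAct D p (L (head22 (comoduleMap u)) z) =
      m₀ (L (headAct D p ∘ₗ L (head11 u) ∘ₗ L Δ₀) (head22 D.χ z)) := by
  have h : head22 (X := X) (comoduleMap u) = m₀ ∘ₗ L (head11 u) ∘ₗ L Δ₀ :=
    LinearMap.ext (head22_comoduleMap u)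
  rw [h]
  simp only [headAct, lTensor_comp, LinearMap.comp_apply]
  rw [χ_mul, ← head21_lTensor (LinearMap.mul' k A), mul_mul, head22_lTensor, head22_lTensor]

theorem headCrossedMul_comoduleMap (hcc : D.Cocomm) {u : H →ₗ[k] A}
    (hc : D.s ∘ₗ lTensor H u = rTensor H u ∘ₗ D.c)
    (hu : LinearMap.mul' k A ∘ₗ lTensor A u ∘ₗ D.s = LinearMap.mul' k A ∘ₗ rTensor A u)
    (p : H ⊗[k] H →ₗ[k] A) (z : A ⊗[k] (H ⊗[k] (A ⊗[k] (H ⊗[k] X)))) :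
    headCrossedMul D p (head22 (comoduleMap u) (L (L (head22 (comoduleMap u))) z)) =
      headCrossedMul D (conv2 D (conv2 D (d0₁ D u) (d2₁ u)) p) z := by
  have hJ (y : H ⊗[k] (H ⊗[k] X)) :
      head22 (Ffmap D (conv2 D (conv2 D (d0₁ D u) (d2₁ u)) p)) y =
        m₀ (L (headAct D p ∘ₗ L (head11 u) ∘ₗ L Δ₀) (head11 u (Δ₀ y))) := by
    rw [← headAct_comoduleMap_comul D hcc hc hu]
    simp only [lTensor_comp, LinearMap.comp_apply, head12_lTensor, head11_lTensor]
  have hG (y : H ⊗[k] (A ⊗[k] (H ⊗[k] X))) :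
      m₀ (L (headAct D p) (head11 u (Δ₀ (L (head22 (comoduleMap u)) y)))) =
        headAct D (conv2 D (conv2 D (d0₁ D u) (d2₁ u)) p) y := by
    have hF := LinearMap.ext hJ (f := _)
      (g := m₀ ∘ₗ L (headAct D p ∘ₗ L (head11 u) ∘ₗ L Δ₀) ∘ₗ head11 u ∘ₗ Δ₀)
    rw [headAct_apply, hF, head12_lTensor, head11_lTensor,
      lift23 (headAct_comoduleMap D u p), ← mul_mul, head21_lTensor, ← head11_lTensor,
      ← comoduleMap_χ D hcc hu, head22_comoduleMap, ← head21_lTensor (LinearMap.mul' k A), mul_mul]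
    simp only [lTensor_comp, LinearMap.comp_apply]
  rw [headCrossedMul_apply, headCrossedMul_apply, head22_comoduleMap,
    ← head21_lTensor (LinearMap.mul' k A), mul_mul]
  simp only [← lTensor_comp_apply]
  exact congrArg _ (lTensor_congr hG z)

end Multiplicative

/-! ### Equivalences of crossed products -/

section Equivalences

variable {X : Type*} [AddCommMonoid X] [Module k X]

local notation "ε₀" => head10 (Coalgebra.counit (R := k) (A := H))
local notation "Δ₀" => head12 (Coalgebra.comul (R := k) (A := H))
local notation "μ₀" => head21 (LinearMap.mul' k H)
local notation "m₀" => head21 (LinearMap.mul' k A)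
local notation "L" => LinearMap.lTensor _
local notation "ηH" => TensorProduct.mk k H _ 1
local notation "ηA" => TensorProduct.mk k A _ 1

theorem headCrossedMul_mk_one (p : H ⊗[k] H →ₗ[k] A) (z : H ⊗[k] (H ⊗[k] X)) :
    headCrossedMul D p (ηA (L ηA z)) = head22 (Ffmap D p) z := by
  rw [headCrossedMul_apply, lTensor_mk, head21_mul'_mk_one, headAct_apply, χ_lTensor_mk_one,
    lTensor_mk, head21_mul'_mk_one]

theorem comoduleMap_multiplicative_iff (hcc : D.Cocomm) {u : H →ₗ[k] A}
    (hc : D.s ∘ₗ lTensor H u = rTensor H u ∘ₗ D.c)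
    (hu : LinearMap.mul' k A ∘ₗ lTensor A u ∘ₗ D.s = LinearMap.mul' k A ∘ₗ rTensor A u)
    (f f' : H ⊗[k] H →ₗ[k] A) :
    comoduleMap u ∘ₗ crossedMul D f =
        crossedMul D f' ∘ₗ TensorProduct.map (comoduleMap u) (comoduleMap u) ↔
      conv2 D (conv2 D (d0₁ D u) (d2₁ u)) f' = conv2 D f (d1₁ u) := by
  rw [crossedMul_comp_iff]
  simp only [comoduleMap_headCrossedMul, headCrossedMul_comoduleMap D hcc hc hu]
  constructor
  · intro h
    refine Ffmap_injective D fun z => ?_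
    rw [← headCrossedMul_mk_one, ← headCrossedMul_mk_one, h]
  · intro h z
    rw [h]

theorem head21_lTensor_mk_one {f : H ⊗[k] H →ₗ[k] A}
    (hf : ∀ h : H, f (h ⊗ₜ[k] (1 : H)) = Coalgebra.counit (R := k) h • (1 : A))
    (z : H ⊗[k] X) : head21 f (L ηH z) = ηA (ε₀ z) := by
  induction z with
  | zero => simp
  | add z w hz hw => simp only [map_add, hz, hw]
  | tmul a x => simp [hf, smul_tmul]

theorem head22_Ffmap_lTensor_mk_one {f : H ⊗[k] H →ₗ[k] A}
    (hf : ∀ h : H, f (h ⊗ₜ[k] (1 : H)) = Coalgebra.counit (R := k) h • (1 : A))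
    (z : H ⊗[k] X) : head22 (Ffmap D f) (L ηH z) = ηA z := by
  rw [head22_Ffmap, headComul2_apply, lift22 (comul_mk_one D), head12_lTensor, head12_lTensor,
    lift21 (braid_lTensor_mk_one D), lift22 (lTensor_mk (1 : H) μ₀),
    lift20 head21_mul'_lTensor_mk_one, head21_lTensor_mk_one hf, counit_comul]

theorem headAct_lTensor_mk_one {f : H ⊗[k] H →ₗ[k] A}
    (hf : ∀ h : H, f (h ⊗ₜ[k] (1 : H)) = Coalgebra.counit (R := k) h • (1 : A))
    (z : H ⊗[k] (A ⊗[k] X)) : headAct D f (L (L ηH) z) = head22 D.χ z := by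
  rw [headAct_apply, head22_lTensor, lift21 (head22_Ffmap_lTensor_mk_one D hf),
    head21_mul'_lTensor_mk_one]

theorem head11_mk_one {B C : Type*} [Ring B] [Algebra k B] [Ring C] [Algebra k C] {u : B →ₗ[k] C}
    (hu : u 1 = 1) (x : X) :
    head11 u (TensorProduct.mk k B X 1 x) = TensorProduct.mk k C X 1 x := by
  simp [hu]

theorem comoduleMap_lTensor_mk_one (D : ModAlgData k H A) {u : H →ₗ[k] A} (hu : u 1 = 1)
    (z : A ⊗[k] X) : head22 (comoduleMap u) (L ηH z) = L ηH z := by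
  rw [head22_comoduleMap, lift22 (comul_mk_one D), lift21 (head11_mk_one hu),
    head21_mul'_lTensor_mk_one]

/-- A comodule map which is multiplicative for normal `f` and `f'` comes from a central map. -/
theorem central_of_multiplicative (hcc : D.Cocomm) {u : H →ₗ[k] A} (hu : u 1 = 1)
    {f f' : H ⊗[k] H →ₗ[k] A}
    (hf : ∀ h : H, f (h ⊗ₜ[k] (1 : H)) = Coalgebra.counit (R := k) h • (1 : A))
    (hf' : ∀ h : H, f' (h ⊗ₜ[k] (1 : H)) = Coalgebra.counit (R := k) h • (1 : A))
    (hmul : comoduleMap u ∘ₗ crossedMul D f =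
      crossedMul D f' ∘ₗ TensorProduct.map (comoduleMap u) (comoduleMap u)) :
    LinearMap.mul' k A ∘ₗ lTensor A u ∘ₗ D.s = LinearMap.mul' k A ∘ₗ rTensor A u := by
  rw [crossedMul_comp_iff] at hmul
  have key (y : H ⊗[k] (A ⊗[k] k)) :
      head22 (comoduleMap u) (head22 D.χ y) = m₀ (head11 u (L (head22 D.χ) (Δ₀ y))) := by
    have h := hmul (ηA (L (L ηH) y))
    rwa [headCrossedMul_apply, headCrossedMul_apply, lTensor_mk, head21_mul'_mk_one,
      headAct_lTensor_mk_one D hf, lTensor_mk, lift21 (comoduleMap_lTensor_mk_one D hu),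
      comoduleMap_mk_one, head12_lTensor, head11_lTensor,
      lift21 (headAct_lTensor_mk_one D hf'), ← head11_lTensor] at h
  refine central_of_head D fun z => ?_
  have h := congrArg (L ε₀) (key (L (head21 D.ρ) (L (head11 D.antipode) (Δ₀ z))))
  rw [counit_comoduleMap, χ_eq D hcc, action_comul_surjective, ← head21_lTensor,
    ← head11_lTensor, lift21 (lTensor_counit_χ D), action_comul_surjective] at h
  exact h

theorem compatible_of_head {u : H →ₗ[k] A}
    (hu : ∀ z : H ⊗[k] (H ⊗[k] k), head22 D.s (L (head11 u) z) = head11 u (head22 D.c z)) :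
    D.s ∘ₗ lTensor H u = rTensor H u ∘ₗ D.c := by
  refine LinearMap.ext fun t => ?_
  have h := hu (L (append 1) t)
  rw [lift22 (head11_append u (1 : k)), head22_append, head22_append, head11_lTensor] at h
  exact (LinearEquiv.lTensor A (TensorProduct.rid k H).symm).injective h

/-- Compatibility of a map with the transposition of the crossed product in terms of leading
factors. -/
theorem shat_comp_iff (g : A ⊗[k] H →ₗ[k] A ⊗[k] H) :
    rTensor H g ∘ₗ D.shat = D.shat ∘ₗ lTensor H g ↔
      ∀ z : H ⊗[k] (A ⊗[k] (H ⊗[k] k)), head22 g (L (head22 D.c) (head22 D.s z)) =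
        L (head22 D.c) (head22 D.s (L (head22 g) z)) := by
  have key (t : H ⊗[k] (A ⊗[k] H)) (x : k) :
      L (head22 D.c) (head22 D.s (L (L (append x)) t)) =
        L (L (append x)) (TensorProduct.assoc k A H H (D.shat t)) := by
    rw [head22_lTensor, lift22 (head22_append D.c x)]
    simp only [ModAlgData.shat, LinearMap.comp_apply, LinearEquiv.coe_coe,
      LinearEquiv.apply_symm_apply]
    rfl
  have key' (t : (A ⊗[k] H) ⊗[k] H) (x : k) :
      head22 g (L (L (append x)) (TensorProduct.assoc k A H H t)) =
        L (L (append x)) (TensorProduct.assoc k A H H (rTensor H g t)) := by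
    rw [head22_lTensor]
    simp [head22]
  constructor
  · intro h z
    induction z using append_induction_three with
    | h0 => simp only [map_zero]
    | ha z w hz hw => simp only [map_add, hz, hw]
    | ht x t =>
      rw [key, key', lift22 (head22_append g x), key]
      congr 2
      exact LinearMap.congr_fun h t
  · intro h
    refine LinearMap.ext fun t => ?_
    have h1 := h (L (L (append 1)) t)
    rw [key, key', lift22 (head22_append g 1), key] at h1
    exact (TensorProduct.assoc k A H H).injective
      ((LinearEquiv.lTensor A (LinearEquiv.lTensor H (TensorProduct.rid k H).symm)).injective h1)

theorem compatible_of_shat {u : H →ₗ[k] A}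
    (h : rTensor H (comoduleMap u) ∘ₗ D.shat = D.shat ∘ₗ lTensor H (comoduleMap u)) :
    D.s ∘ₗ lTensor H u = rTensor H u ∘ₗ D.c := by
  rw [shat_comp_iff] at h
  refine compatible_of_head D fun z => ?_
  have h1 := congrArg (L ε₀) (h (L ηA z))
  rw [transposition_lTensor_mk_one, lTensor_mk, counit_comoduleMap, lTensor_mk,
    head21_mul'_mk_one, lift21 (counit_braid D), ← head22_lTensor,
    lift22 (comoduleMap_mk_one u), lift22 (fun y => (head11_lTensor u ε₀ y).symm),
    lift20 lTensor_counit_comul] at h1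
  exact h1.symm

theorem shat_of_compatible {u : H →ₗ[k] A}
    (hc : D.s ∘ₗ lTensor H u = rTensor H u ∘ₗ D.c) :
    rTensor H (comoduleMap u) ∘ₗ D.shat = D.shat ∘ₗ lTensor H (comoduleMap u) := by
  rw [shat_comp_iff]
  intro z
  have h : head22 (X := k) (comoduleMap u) = m₀ ∘ₗ L (head11 u) ∘ₗ L Δ₀ :=
    LinearMap.ext (head22_comoduleMap u)
  have hG : head22 (X := H ⊗[k] k) (comoduleMap u) = m₀ ∘ₗ L (head11 u) ∘ₗ L Δ₀ :=
    LinearMap.ext (head22_comoduleMap u)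
  rw [h, hG]
  simp only [lTensor_comp, LinearMap.comp_apply]
  rw [lift23 (comul_braid D), transposition_mul D, head22_lTensor, head22_lTensor,
    lift22 (transposition_compatible D hc), ← head21_lTensor, lift22 (head11_lTensor u _)]

theorem comoduleMap_comp (u v : H →ₗ[k] A) :
    comoduleMap u ∘ₗ comoduleMap v = comoduleMap (conv1 v u) := by
  refine head22_injective fun z => ?_
  have h : head22 (comoduleMap u ∘ₗ comoduleMap v) z =
      head22 (comoduleMap u) (head22 (comoduleMap v) z) := by
    simp [head22, rTensor_comp]
  have hc : head11 (X := H ⊗[k] k) (conv1 v u) = m₀ ∘ₗ head11 v ∘ₗ L (head11 u) ∘ₗ Δ₀ :=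
    LinearMap.ext (head11_conv1 v u)
  rw [h, head22_comoduleMap, head22_comoduleMap, head22_comoduleMap, hc,
    ← head21_lTensor, ← head21_lTensor, mul_mul]
  simp only [← lTensor_comp_apply]
  refine congrArg _ (lTensor_congr (fun y => ?_) z)
  simp only [LinearMap.comp_apply]
  rw [← head11_lTensor, ← head11_lTensor, comul_comul]

theorem comoduleMap_unit1 : comoduleMap (unit1 (k := k) (H := H) (A := A)) = LinearMap.id := by
  refine head22_injective fun z => ?_
  have h : head11 (X := H ⊗[k] k) (unit1 (k := k) (H := H) (A := A)) = ηA ∘ₗ ε₀ :=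
    LinearMap.ext head11_unit1
  rw [head22_comoduleMap, h]
  simp only [lTensor_comp, LinearMap.comp_apply]
  rw [lift20 counit_comul, head21_mul'_lTensor_mk_one]
  simp [head22]

theorem comoduleMap_injective {u v : H →ₗ[k] A} (h : comoduleMap u = comoduleMap v) : u = v := by
  refine head11_injective fun z => ?_
  have (w : H →ₗ[k] A) : head11 w z = L ε₀ (head22 (comoduleMap w) (ηA z)) := by
    rw [counit_comoduleMap, lTensor_mk, head21_mul'_mk_one]
  rw [this, this, h]

theorem comoduleMap_mulLeft (u : H →ₗ[k] A) (a : A) :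
    comoduleMap u ∘ₗ rTensor H (LinearMap.mulLeft k a) =
      rTensor H (LinearMap.mulLeft k a) ∘ₗ comoduleMap u := by
  ext b h
  simp only [comoduleMap, AlgebraTensorModule.curry_apply, curry_apply, restrictScalars_self,
    LinearMap.comp_apply, rTensor_tmul, lTensor_tmul, mulLeft_apply]
  induction head11 u (Coalgebra.comul (R := k) h) with
  | zero => simp
  | add z w hz hw => simp only [tmul_add, map_add, hz, hw]
  | tmul c x => simp [mul_assoc]

theorem comoduleMap_colinear (u : H →ₗ[k] A) :
    lTensor A (Coalgebra.comul (R := k)) ∘ₗ comoduleMap u =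
      (TensorProduct.assoc k A H H).toLinearMap ∘ₗ rTensor H (comoduleMap u)
        ∘ₗ (TensorProduct.assoc k A H H).symm.toLinearMap
        ∘ₗ lTensor A (Coalgebra.comul (R := k)) := by
  refine LinearMap.ext fun t => ?_
  refine Eq.trans ?_ (head22_comoduleMap u (L (Coalgebra.comul (R := k)) t)).symm
  rw [lift22 (fun h => Coalgebra.coassoc_apply (R := k) (A := H) h)]
  simp only [comoduleMap, lTensor_comp, LinearMap.comp_apply]
  rw [← head21_lTensor, lift22 (head11_lTensor u _)]

/-- Every left `A`-linear and right `H`-colinear endomorphism is a comodule map. -/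
theorem eq_comoduleMap {g : A ⊗[k] H →ₗ[k] A ⊗[k] H}
    (hl : ∀ a : A, g ∘ₗ rTensor H (LinearMap.mulLeft k a) =
      rTensor H (LinearMap.mulLeft k a) ∘ₗ g)
    (hr : lTensor A (Coalgebra.comul (R := k)) ∘ₗ g =
      (TensorProduct.assoc k A H H).toLinearMap ∘ₗ rTensor H g
        ∘ₗ (TensorProduct.assoc k A H H).symm.toLinearMap
        ∘ₗ lTensor A (Coalgebra.comul (R := k))) :
    ∃ u : H →ₗ[k] A, g = comoduleMap u := by
  let u : H →ₗ[k] A := (TensorProduct.rid k A).toLinearMap ∘ₗ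
    lTensor A (Coalgebra.counit (R := k)) ∘ₗ g ∘ₗ TensorProduct.mk k A H 1
  have hu (t : H ⊗[k] H) : L ε₀ (head22 g (ηA t)) = head11 u t := by
    induction t with
    | zero => simp only [map_zero]
    | add z w hz hw => simp only [map_add, hz, hw]
    | tmul h x =>
      simp only [mk_apply, head22_tmul, head11_tmul, u, LinearMap.comp_apply]
      induction g (1 ⊗ₜ h) with
      | zero => simp
      | add z w hz hw => simp only [add_tmul, map_add, hz, hw]
      | tmul a y => simp [smul_tmul]
  refine ⟨u, ?_⟩
  ext a h
  have h1 : g (1 ⊗ₜ h) = head11 u (Coalgebra.comul (R := k) h) := by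
    have h2 := congrArg (L ε₀) (LinearMap.congr_fun hr (1 ⊗ₜ h))
    have h3 (x : H) : ε₀ (Coalgebra.comul (R := k) x) = x := by
      simp [head10]
    simp only [LinearMap.comp_apply] at h2
    rw [lift20 h3] at h2
    exact h2.trans (hu _)
  have h4 := LinearMap.congr_fun (hl a) (1 ⊗ₜ h)
  have h5 := LinearMap.congr_fun (comoduleMap_mulLeft u a) (1 ⊗ₜ h)
  simp only [LinearMap.comp_apply, rTensor_tmul, mulLeft_apply, mul_one] at h4 h5
  simp only [AlgebraTensorModule.curry_apply, curry_apply, restrictScalars_self]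
  rw [h4, h5, h1]
  congr 1
  simp only [comoduleMap, LinearMap.comp_apply, lTensor_tmul]
  exact (head21_mul'_mk_one _).symm

end Equivalences

/-! ### The classification -/

section Classification

theorem coboundary_iff {M : Type*} [Monoid M] {a b d w f f' g' : M} (hdw : d * w = 1)
    (hwd : w * d = 1) (hfg : f' * g' = 1) (hgf : g' * f' = 1) (hf : f' * d = d * f')
    (hb : b * d = d * b) : a * b * f' = f * d ↔ f * g' = a * w * b := by
  have hc {x : M} (hx : x * d = d * x) : x * w = w * x :=
    calc x * w = w * d * x * w := by rw [hwd, one_mul]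
      _ = w * (x * d) * w := by rw [hx, mul_assoc w]
      _ = w * x := by rw [mul_assoc, mul_assoc, hdw, mul_one]
  constructor
  · intro h
    calc f * g' = f * d * w * g' := by rw [mul_assoc f, hdw, mul_one]
      _ = a * b * (f' * w) * g' := by rw [← h, mul_assoc (a * b)]
      _ = a * (b * w) * (f' * g') := by rw [hc hf]; simp only [mul_assoc]
      _ = a * w * b := by rw [hfg, mul_one, hc hb, mul_assoc]
  · intro h
    calc a * b * f' = a * (w * d) * b * f' := by rw [hwd, mul_one]
      _ = a * w * (d * b) * f' := by simp only [mul_assoc]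
      _ = a * w * b * (d * f') := by rw [← hb]; simp only [mul_assoc]
      _ = f * (g' * f') * d := by rw [← h, ← hf]; simp only [mul_assoc]
      _ = f * d := by rw [hgf, mul_one]

/-- The convolution monoid `Hom_k(H ⊗ H, A)`. -/
abbrev convMonoid : Monoid (H ⊗[k] H →ₗ[k] A) where
  mul := conv2 D
  one := unit2
  mul_assoc := conv2_assoc D
  one_mul := unit2_conv2 D
  mul_one := conv2_unit2 D

theorem coboundary_relation_iff (hcc : D.Cocomm) {u : H →ₗ[k] A}
    (hc : D.s ∘ₗ lTensor H u = rTensor H u ∘ₗ D.c)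
    (hu : LinearMap.mul' k A ∘ₗ lTensor A u ∘ₗ D.s = LinearMap.mul' k A ∘ₗ rTensor A u)
    {f f' g' w : H ⊗[k] H →ₗ[k] A} (hf' : f' ∈ Reg2 D)
    (hdw : conv2 D (d1₁ u) w = unit2) (hwd : conv2 D w (d1₁ u) = unit2)
    (hfg : conv2 D f' g' = unit2) (hgf : conv2 D g' f' = unit2) :
    conv2 D (conv2 D (d0₁ D u) (d2₁ u)) f' = conv2 D f (d1₁ u) ↔
      conv2 D f g' = conv2 D (conv2 D (d0₁ D u) w) (d2₁ u) :=
  letI := convMonoid D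
  coboundary_iff (M := H ⊗[k] H →ₗ[k] A) hdw hwd hfg hgf
    (conv2_d1₁_comm D hcc hc (mul_central_two D hf'.2.1))
    (conv2_d1₁_comm D hcc hc (d2₁_central D hu))

theorem coboundRel_iff_inCoboundImage (hcc : D.Cocomm) {f f' : H ⊗[k] H →ₗ[k] A}
    (hf' : f' ∈ Reg2 D) : CoboundRel D f f' ↔ InCoboundImage D f f' := by
  constructor
  · rintro ⟨u, hu, h⟩ g' hfg hgf
    obtain ⟨v, huv, hvu⟩ := hu.2.2.2
    have hdw : conv2 D (d1₁ u) (d1₁ v) = unit2 := by rw [← d1₁_conv1, huv, d1₁_unit1 D]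
    have hwd : conv2 D (d1₁ v) (d1₁ u) = unit2 := by rw [← d1₁_conv1, hvu, d1₁_unit1 D]
    exact ⟨u, hu, d1₁ v, hdw, hwd,
      (coboundary_relation_iff D hcc hu.1 hu.2.1 hf' hdw hwd hfg hgf).1 h⟩
  · intro h
    obtain ⟨g', hfg, hgf⟩ := hf'.2.2.2
    obtain ⟨u, hu, w, hdw, hwd, h⟩ := h g' hfg hgf
    exact ⟨u, hu, (coboundary_relation_iff D hcc hu.1 hu.2.1 hf' hdw hwd hfg hgf).2 h⟩

theorem comoduleMap_one_tmul_one (D : ModAlgData k H A) (u : H →ₗ[k] A) :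
    comoduleMap u ((1 : A) ⊗ₜ[k] (1 : H)) = u 1 ⊗ₜ[k] (1 : H) := by
  simp [comoduleMap, D.comul_one]

theorem coboundRel_of_crossedEquiv (hcc : D.Cocomm) {f f' : H ⊗[k] H →ₗ[k] A}
    (hf : f ∈ Reg2 D) (hf' : f' ∈ Reg2 D) (h : CrossedEquiv D f f') : CoboundRel D f f' := by
  obtain ⟨g, hbij, hmul, hone, hl, hr, hs⟩ := h
  obtain ⟨u, rfl⟩ := eq_comoduleMap hl hr
  let e := LinearEquiv.ofBijective (comoduleMap u) hbij
  have he (t : A ⊗[k] H) : comoduleMap u (e.symm t) = t := e.apply_symm_apply t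
  have he' (t : A ⊗[k] H) : e.symm (comoduleMap u t) = t := e.symm_apply_apply t
  obtain ⟨v, hv⟩ : ∃ v : H →ₗ[k] A, e.symm.toLinearMap = comoduleMap v := by
    refine eq_comoduleMap (fun a => LinearMap.ext fun t => hbij.1 ?_)
      (LinearMap.ext fun t => ?_)
    · have := LinearMap.congr_fun (hl a) (e.symm t)
      simp only [LinearMap.comp_apply, LinearEquiv.coe_coe, he] at this ⊢
      exact this.symm
    · obtain ⟨t, rfl⟩ := hbij.2 t
      have := LinearMap.congr_fun hr t
      have hid : rTensor H e.symm.toLinearMap ∘ₗ rTensor H (comoduleMap u) = LinearMap.id := by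
        rw [← rTensor_comp, ← rTensor_id]
        exact congrArg _ (LinearMap.ext he')
      have hid' (y : (A ⊗[k] H) ⊗[k] H) :
          rTensor H e.symm.toLinearMap (rTensor H (comoduleMap u) y) = y :=
        LinearMap.congr_fun hid y
      simp only [LinearMap.comp_apply, LinearEquiv.coe_coe, he'] at this ⊢
      rw [this, LinearEquiv.symm_apply_apply, hid', LinearEquiv.apply_symm_apply]
  have hu1 : u 1 = 1 := by
    rw [comoduleMap_one_tmul_one D] at hone
    have := congrArg (fun t => TensorProduct.rid k A
      (lTensor A (Coalgebra.counit (R := k)) t)) hone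
    simpa [D.counit_one] using this
  have hc := compatible_of_shat D hs
  have hz := central_of_multiplicative D hcc hu1 (fun h => (hf.2.2.1 h).2)
    (fun h => (hf'.2.2.1 h).2) hmul
  refine ⟨u, ⟨hc, hz, hu1, v, ?_, ?_⟩,
    (comoduleMap_multiplicative_iff D hcc hc hz f f').1 hmul⟩
  · apply comoduleMap_injective
    rw [← comoduleMap_comp, ← hv, comoduleMap_unit1]
    exact LinearMap.ext he'
  · apply comoduleMap_injective
    rw [← comoduleMap_comp, ← hv, comoduleMap_unit1]
    exact LinearMap.ext he

theorem crossedEquiv_of_coboundRel (hcc : D.Cocomm) {f f' : H ⊗[k] H →ₗ[k] A}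
    (h : CoboundRel D f f') : CrossedEquiv D f f' := by
  obtain ⟨u, ⟨hc, hz, hu1, v, huv, hvu⟩, h⟩ := h
  refine ⟨comoduleMap u, Function.bijective_iff_has_inverse.2 ⟨comoduleMap v, ?_, ?_⟩,
    (comoduleMap_multiplicative_iff D hcc hc hz f f').2 h, ?_, comoduleMap_mulLeft u,
    comoduleMap_colinear u, shat_of_compatible D hc⟩
  · intro t
    rw [← LinearMap.comp_apply, comoduleMap_comp, huv, comoduleMap_unit1, LinearMap.id_apply]
  · intro t
    rw [← LinearMap.comp_apply, comoduleMap_comp, hvu, comoduleMap_unit1, LinearMap.id_apply]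
  · rw [comoduleMap_one_tmul_one D, hu1]

theorem crossedEquiv_iff_coboundRel (hcc : D.Cocomm) {f f' : H ⊗[k] H →ₗ[k] A}
    (hf : f ∈ Reg2 D) (hf' : f' ∈ Reg2 D) : CrossedEquiv D f f' ↔ CoboundRel D f f' :=
  ⟨coboundRel_of_crossedEquiv D hcc hf hf', crossedEquiv_of_coboundRel D hcc⟩

end Classification

end BraidedCrossedProduct

/-- two crossed products `A#_f H`, `A#_{f'} H` (with `f, f'` normalized
convolution-invertible 2-cocycles) are equivalent iff there is `u ∈ Reg₊ˢ(H, A)` with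
`δ⁰(u) * δ²(u) * f' = f * δ¹(u)`, equivalently iff `f * (f')⁻¹` is a coboundary
`D¹(u) = δ⁰(u) * δ¹(u)⁻¹ * δ²(u)`; consequently `H²(H, A, s)` is in bijective
correspondence with the set of equivalence classes of crossed products of `(A, s)` with
`H` whose cocycle is convolution invertible. -/
theorem crossed_products_classified_by_H2
    (D : ModAlgData k H A) (hcc : D.Cocomm) :
    (∀ f f' : H ⊗[k] H →ₗ[k] A, f ∈ Reg2 D → f' ∈ Reg2 D →
      IsCocycle2 D f → IsCocycle2 D f' →
        (CrossedEquiv D f f' ↔ CoboundRel D f f') ∧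
        (CrossedEquiv D f f' ↔ InCoboundImage D f f')) ∧
    Nonempty
      (Quot (fun p q : {f : H ⊗[k] H →ₗ[k] A // f ∈ Reg2 D ∧ IsCocycle2 D f} =>
          CrossedEquiv D p.1 q.1) ≃
        Quot (fun p q : {f : H ⊗[k] H →ₗ[k] A // f ∈ Reg2 D ∧ IsCocycle2 D f} =>
          CoboundRel D p.1 q.1)) := by
  have key := fun f f' hf hf' =>
    BraidedCrossedProduct.crossedEquiv_iff_coboundRel D hcc (f := f) (f' := f') hf hf'
  refine ⟨fun f f' hf hf' _ _ => ⟨key f f' hf hf', (key f f' hf hf').trans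
    (BraidedCrossedProduct.coboundRel_iff_inCoboundImage D hcc hf')⟩, ?_⟩
  exact ⟨Quot.congr (Equiv.refl _) fun p q => key p.1 q.1 p.2.1 q.2.1⟩
end
end

section
/- Let k be a field, (H, c) a cocommutative braided Hopf algebra over k, and (A, s) a left H-module algebra with action ρ. Let u : H → A be a convolution-invertible linear map with convolution inverse u⁻¹. Then ρ = μ_A∘(μ_A⊗u)∘(u⁻¹⊗χ)∘(Δ⊗A) as maps H⊗A → A, where χ := (ρ⊗H)∘(H⊗s)∘(Δ⊗A) : H⊗A → A⊗H, if and only if u is s-central, i.e. μ_A∘(A⊗u)∘s = μ_A∘(u⊗A). -/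
open TensorProduct LinearMap

noncomputable section

set_option maxHeartbeats 1000000

variable {k H A : Type*} [Field k] [Ring H] [Algebra k H] [Coalgebra k H]
  [Ring A] [Algebra k A]

theorem conv1_assoc (f g l : H →ₗ[k] A) : conv1 f (conv1 g l) = conv1 (conv1 f g) l := by
  ext h
  have key : ∀ t : (H ⊗[k] H) ⊗[k] H,
      LinearMap.mul' k A (TensorProduct.map f (LinearMap.mul' k A ∘ₗ TensorProduct.map g l)
        (TensorProduct.assoc k H H H t)) =
      LinearMap.mul' k A (TensorProduct.map (LinearMap.mul' k A ∘ₗ TensorProduct.map f g) l t) := by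
    intro t
    rw [← LinearEquiv.coe_coe, ← LinearMap.comp_apply, ← LinearMap.comp_apply,
      ← LinearMap.comp_apply]
    congr 1
    ext x y z
    simp [mul_assoc]
  have hk := key (rTensor H (Coalgebra.comul (R := k)) (Coalgebra.comul (R := k) h))
  rw [Coalgebra.coassoc_apply] at hk
  simpa only [conv1, LinearMap.comp_apply, lTensor, rTensor, ← TensorProduct.map_comp,
    LinearMap.comp_id, ← LinearMap.comp_assoc, ← LinearMap.comp_apply] using hk

theorem unit1_conv1 (f : H →ₗ[k] A) : conv1 unit1 f = f := by
  have e : LinearMap.mul' k A ∘ₗ TensorProduct.map (Algebra.linearMap k A) f =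
      f ∘ₗ (TensorProduct.lid k H).toLinearMap := by
    ext x
    simp
  have hconv : conv1 unit1 f =
      (LinearMap.mul' k A ∘ₗ TensorProduct.map (Algebra.linearMap k A) f) ∘ₗ
        rTensor H (Coalgebra.counit (R := k)) ∘ₗ Coalgebra.comul (R := k) := by
    rw [conv1, unit1, ← map_comp_rTensor]
    rfl
  rw [hconv, e]
  ext h
  simp

/-- The convolution action of `Hom_k(H, A)` on `Hom_k(H ⊗ M, A)`. -/
def convTensor {M : Type*} [AddCommGroup M] [Module k M]
    (f : H →ₗ[k] A) (F : H ⊗[k] M →ₗ[k] A) : H ⊗[k] M →ₗ[k] A :=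
  LinearMap.mul' k A ∘ₗ TensorProduct.map f F ∘ₗ (TensorProduct.assoc k H H M).toLinearMap
    ∘ₗ rTensor M (Coalgebra.comul (R := k))

theorem convTensor_comp_mk {M : Type*} [AddCommGroup M] [Module k M]
    (f : H →ₗ[k] A) (F : H ⊗[k] M →ₗ[k] A) (m : M) :
    convTensor f F ∘ₗ (TensorProduct.mk k H M).flip m =
      conv1 f (F ∘ₗ (TensorProduct.mk k H M).flip m) := by
  ext h
  simp only [convTensor, conv1, LinearMap.comp_apply, LinearMap.flip_apply,
    TensorProduct.mk_apply, rTensor_tmul]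
  induction Coalgebra.comul (R := k) h with
  | zero => simp
  | tmul x y => simp
  | add x y hx hy => simp only [TensorProduct.add_tmul, map_add, hx, hy]

theorem convTensor_convTensor_of_conv1_eq_unit1 {M : Type*} [AddCommGroup M] [Module k M]
    {f g : H →ₗ[k] A} (hfg : conv1 f g = unit1) (F : H ⊗[k] M →ₗ[k] A) :
    convTensor f (convTensor g F) = F :=
  TensorProduct.ext' fun x m => by
    have h : convTensor f (convTensor g F) ∘ₗ (TensorProduct.mk k H M).flip m =
        F ∘ₗ (TensorProduct.mk k H M).flip m := by
      rw [convTensor_comp_mk, convTensor_comp_mk, conv1_assoc, hfg, unit1_conv1]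
    exact LinearMap.congr_fun h x

/-- The map `(H⊗ρ)∘(Δ⊗A) : H⊗A → H⊗A`. -/
def ModAlgData.coact (D : ModAlgData k H A) : H ⊗[k] A →ₗ[k] H ⊗[k] A :=
  lTensor H D.ρ ∘ₗ (TensorProduct.assoc k H H A).toLinearMap
    ∘ₗ rTensor A (Coalgebra.comul (R := k))

theorem ModAlgData.coact_lTensor_antipode_comul (D : ModAlgData k H A) (h : H) (a : A) :
    D.coact (lTensor H (D.ρ ∘ₗ (TensorProduct.mk k H A).flip a ∘ₗ D.antipode)
      (Coalgebra.comul (R := k) h)) = h ⊗ₜ[k] a := by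
  set r : H →ₗ[k] A := D.ρ ∘ₗ (TensorProduct.mk k H A).flip a with hr
  have hassoc : ∀ t : H ⊗[k] H,
      D.coact (lTensor H (D.ρ ∘ₗ (TensorProduct.mk k H A).flip a ∘ₗ D.antipode) t) =
      lTensor H (r ∘ₗ LinearMap.mul' k H ∘ₗ lTensor H D.antipode)
        (TensorProduct.assoc k H H H (rTensor H (Coalgebra.comul (R := k)) t)) := by
    intro t
    induction t with
    | zero => simp
    | add x y hx hy => simp only [map_add, hx, hy]
    | tmul x y =>
      simp only [ModAlgData.coact, LinearMap.comp_apply, lTensor_tmul, rTensor_tmul]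
      induction Coalgebra.comul (R := k) x with
      | zero => simp
      | add x y hx hy => simp only [TensorProduct.add_tmul, map_add, hx, hy]
      | tmul p q =>
        have hmul : D.ρ ((q * D.antipode y) ⊗ₜ[k] a) =
            D.ρ (q ⊗ₜ[k] D.ρ (D.antipode y ⊗ₜ[k] a)) := by
          simpa using LinearMap.congr_fun D.ρ_mul ((q ⊗ₜ[k] D.antipode y) ⊗ₜ[k] a)
        simp [hr, hmul]
  have hunit : (r ∘ₗ LinearMap.mul' k H ∘ₗ lTensor H D.antipode) ∘ₗ Coalgebra.comul (R := k) =
      LinearMap.toSpanSingleton k A a ∘ₗ Coalgebra.counit (R := k) := by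
    rw [LinearMap.comp_assoc, LinearMap.comp_assoc (Coalgebra.comul (R := k)), D.antipode_right]
    ext x
    simp [hr, Algebra.algebraMap_eq_smul_one, D.ρ_one]
  rw [hassoc, Coalgebra.coassoc_apply, ← LinearMap.comp_apply, ← lTensor_comp, hunit,
    lTensor_comp, LinearMap.comp_apply, Coalgebra.lTensor_counit_comul]
  simp

theorem ModAlgData.coact_surjective (D : ModAlgData k H A) : Function.Surjective D.coact := by
  intro t
  induction t with
  | zero => exact ⟨0, map_zero _⟩
  | tmul h a => exact ⟨_, D.coact_lTensor_antipode_comul h a⟩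
  | add x y hx hy =>
    obtain ⟨p, rfl⟩ := hx
    obtain ⟨q, rfl⟩ := hy
    exact ⟨p + q, map_add _ _ _⟩

theorem ModAlgData.s_comp_coact (D : ModAlgData k H A) (hcc : D.Cocomm) :
    D.s ∘ₗ D.coact = D.χ := by
  have h1 : D.s ∘ₗ D.coact = (D.s ∘ₗ lTensor H D.ρ) ∘ₗ
      (TensorProduct.assoc k H H A).toLinearMap ∘ₗ rTensor A (Coalgebra.comul (R := k)) := rfl
  rw [h1, D.s_ρ, ModAlgData.χ]
  nth_rewrite 2 [← hcc.2]
  rw [rTensor_comp]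
  ext
  simp

theorem ModAlgData.convTensor_ρ (D : ModAlgData k H A) (u : H →ₗ[k] A) :
    convTensor u D.ρ = (LinearMap.mul' k A ∘ₗ rTensor A u) ∘ₗ D.coact := by
  have h : TensorProduct.map u D.ρ = rTensor A u ∘ₗ lTensor H D.ρ := by
    rw [rTensor_comp_lTensor]
  rw [convTensor, h]
  rfl

/-- Proposition 3.3: for a cocommutative braided Hopf algebra `H` and a left
`H`-module algebra `(A, s)`, a convolution invertible `u : H → A` satisfies
`ρ = μ_A∘(μ_A⊗u)∘(u⁻¹⊗χ)∘(Δ⊗A)` iff `u` is `s`-central. -/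
theorem cocycle_action_condition_iff_s_central
    (D : ModAlgData k H A) (hcc : D.Cocomm)
    (u v : H →ₗ[k] A)
    (huv : conv1 u v = unit1) (hvu : conv1 v u = unit1) :
    (D.ρ = LinearMap.mul' k A ∘ₗ TensorProduct.map (LinearMap.mul' k A) u
        ∘ₗ (TensorProduct.assoc k A A H).symm.toLinearMap
        ∘ₗ TensorProduct.map v D.χ
        ∘ₗ (TensorProduct.assoc k H H A).toLinearMap
        ∘ₗ rTensor A (Coalgebra.comul (R := k))) ↔
      LinearMap.mul' k A ∘ₗ lTensor A u ∘ₗ D.s = LinearMap.mul' k A ∘ₗ rTensor A u := by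
  have hmul : LinearMap.mul' k A ∘ₗ TensorProduct.map (LinearMap.mul' k A) u
        ∘ₗ (TensorProduct.assoc k A A H).symm.toLinearMap =
      LinearMap.mul' k A ∘ₗ lTensor A (LinearMap.mul' k A ∘ₗ lTensor A u) := by
    ext x y z
    simp [mul_assoc]
  have hrhs : LinearMap.mul' k A ∘ₗ TensorProduct.map (LinearMap.mul' k A) u
        ∘ₗ (TensorProduct.assoc k A A H).symm.toLinearMap
        ∘ₗ TensorProduct.map v D.χ
        ∘ₗ (TensorProduct.assoc k H H A).toLinearMap
        ∘ₗ rTensor A (Coalgebra.comul (R := k)) =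
      convTensor v ((LinearMap.mul' k A ∘ₗ lTensor A u ∘ₗ D.s) ∘ₗ D.coact) := by
    have h : (LinearMap.mul' k A ∘ₗ lTensor A u ∘ₗ D.s) ∘ₗ D.coact =
        (LinearMap.mul' k A ∘ₗ lTensor A u) ∘ₗ D.χ := by
      rw [← D.s_comp_coact hcc]
      rfl
    rw [h, convTensor, ← lTensor_comp_map]
    exact congrArg (· ∘ₗ TensorProduct.map v D.χ ∘ₗ
      (TensorProduct.assoc k H H A).toLinearMap ∘ₗ rTensor A (Coalgebra.comul (R := k))) hmul
  rw [hrhs, ← LinearMap.cancel_right (g := D.coact) (f := LinearMap.mul' k A ∘ₗ _)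
    D.coact_surjective, ← D.convTensor_ρ]
  constructor
  · intro h
    rw [h, convTensor_convTensor_of_conv1_eq_unit1 huv]
  · intro h
    rw [h, convTensor_convTensor_of_conv1_eq_unit1 hvu]
end
end

section
/- Let (C, ς, A, ψ) be an entwining structure over a field k. Then the set of linear maps f : C → A that are compatible with ψ is a unital subalgebra of the convolution algebra Hom_k(C, A): it is a linear subspace, the convolution unit η∘ε is compatible with ψ, and if f and g are compatible with ψ then so is f*g. -/
open TensorProduct LinearMap

noncomputable section

/-- An entwining structure `(C, ς, A, ψ)` over a field `k`: a braided coalgebra `(C, ς)`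
together with an entwining map `ψ : C⊗A → A⊗C` compatible with the algebra structure of `A`,
the coalgebra structure of `C` and with the braid `ς`. -/
structure Entwining (k C A : Type*) [Field k] [AddCommGroup C] [Module k C] [Coalgebra k C]
    [Ring A] [Algebra k A] where
  /-- the braid of `C` -/
  ς : C ⊗[k] C →ₗ[k] C ⊗[k] C
  /-- the entwining map -/
  ψ : C ⊗[k] A →ₗ[k] A ⊗[k] C
  ς_bij : Function.Bijective ς
  ψ_bij : Function.Bijective ψ
  /-- `(ς⊗C)∘(C⊗ς)∘(ς⊗C) = (C⊗ς)∘(ς⊗C)∘(C⊗ς)` -/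
  braid_eq :
    rTensor C ς ∘ₗ (TensorProduct.assoc k C C C).symm.toLinearMap ∘ₗ lTensor C ς
        ∘ₗ (TensorProduct.assoc k C C C).toLinearMap ∘ₗ rTensor C ς =
      (TensorProduct.assoc k C C C).symm.toLinearMap ∘ₗ lTensor C ς
        ∘ₗ (TensorProduct.assoc k C C C).toLinearMap ∘ₗ rTensor C ς
        ∘ₗ (TensorProduct.assoc k C C C).symm.toLinearMap ∘ₗ lTensor C ς
        ∘ₗ (TensorProduct.assoc k C C C).toLinearMap
  /-- `(C⊗ε)∘ς = ε⊗C` -/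
  ς_counit_left :
    (TensorProduct.rid k C).toLinearMap ∘ₗ lTensor C (Coalgebra.counit (R := k)) ∘ₗ ς =
      (TensorProduct.lid k C).toLinearMap ∘ₗ rTensor C (Coalgebra.counit (R := k))
  /-- `(ε⊗C)∘ς = C⊗ε` -/
  ς_counit_right :
    (TensorProduct.lid k C).toLinearMap ∘ₗ rTensor C (Coalgebra.counit (R := k)) ∘ₗ ς =
      (TensorProduct.rid k C).toLinearMap ∘ₗ lTensor C (Coalgebra.counit (R := k))
  /-- `(C⊗Δ)∘ς = (ς⊗C)∘(C⊗ς)∘(Δ⊗C)` -/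
  ς_comul_left :
    lTensor C (Coalgebra.comul (R := k)) ∘ₗ ς =
      (TensorProduct.assoc k C C C).toLinearMap ∘ₗ rTensor C ς
        ∘ₗ (TensorProduct.assoc k C C C).symm.toLinearMap ∘ₗ lTensor C ς
        ∘ₗ (TensorProduct.assoc k C C C).toLinearMap ∘ₗ rTensor C (Coalgebra.comul (R := k))
  /-- `(Δ⊗C)∘ς = (C⊗ς)∘(ς⊗C)∘(C⊗Δ)` -/
  ς_comul_right :
    rTensor C (Coalgebra.comul (R := k)) ∘ₗ ς =
      (TensorProduct.assoc k C C C).symm.toLinearMap ∘ₗ lTensor C ς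
        ∘ₗ (TensorProduct.assoc k C C C).toLinearMap ∘ₗ rTensor C ς
        ∘ₗ (TensorProduct.assoc k C C C).symm.toLinearMap ∘ₗ lTensor C (Coalgebra.comul (R := k))
  /-- `ψ(c⊗1) = 1⊗c` -/
  ψ_one : ∀ c : C, ψ (c ⊗ₜ[k] (1 : A)) = (1 : A) ⊗ₜ[k] c
  /-- `ψ∘(C⊗μ) = (μ⊗C)∘(A⊗ψ)∘(ψ⊗A)` -/
  ψ_mul :
    ψ ∘ₗ lTensor C (LinearMap.mul' k A) =
      rTensor C (LinearMap.mul' k A) ∘ₗ (TensorProduct.assoc k A A C).symm.toLinearMap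
        ∘ₗ lTensor A ψ ∘ₗ (TensorProduct.assoc k A C A).toLinearMap
        ∘ₗ rTensor A ψ ∘ₗ (TensorProduct.assoc k C A A).symm.toLinearMap
  /-- `(A⊗ε)∘ψ = ε⊗A` -/
  ψ_counit :
    (TensorProduct.rid k A).toLinearMap ∘ₗ lTensor A (Coalgebra.counit (R := k)) ∘ₗ ψ =
      (TensorProduct.lid k A).toLinearMap ∘ₗ rTensor A (Coalgebra.counit (R := k))
  /-- `(A⊗Δ)∘ψ = (ψ⊗C)∘(C⊗ψ)∘(Δ⊗A)` -/
  ψ_comul :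
    lTensor A (Coalgebra.comul (R := k)) ∘ₗ ψ =
      (TensorProduct.assoc k A C C).toLinearMap ∘ₗ rTensor C ψ
        ∘ₗ (TensorProduct.assoc k C A C).symm.toLinearMap ∘ₗ lTensor C ψ
        ∘ₗ (TensorProduct.assoc k C C A).toLinearMap ∘ₗ rTensor A (Coalgebra.comul (R := k))
  /-- `(A⊗ς)∘(ψ⊗C)∘(C⊗ψ) = (ψ⊗C)∘(C⊗ψ)∘(ς⊗A)` -/
  ψ_braid :
    lTensor A ς ∘ₗ (TensorProduct.assoc k A C C).toLinearMap ∘ₗ rTensor C ψ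
        ∘ₗ (TensorProduct.assoc k C A C).symm.toLinearMap ∘ₗ lTensor C ψ =
      (TensorProduct.assoc k A C C).toLinearMap ∘ₗ rTensor C ψ
        ∘ₗ (TensorProduct.assoc k C A C).symm.toLinearMap ∘ₗ lTensor C ψ
        ∘ₗ (TensorProduct.assoc k C C A).toLinearMap ∘ₗ rTensor A ς
        ∘ₗ (TensorProduct.assoc k C C A).symm.toLinearMap

variable {k C A : Type*} [Field k] [AddCommGroup C] [Module k C] [Coalgebra k C]
  [Ring A] [Algebra k A]

/-- `f : C → A` is compatible with `ψ` : `ψ∘(C⊗f) = (f⊗C)∘ς`. -/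
def Entwining.Compat (E : Entwining k C A) (f : C →ₗ[k] A) : Prop :=
  E.ψ ∘ₗ lTensor C f = rTensor C f ∘ₗ E.ς

/-- `f : C → A` is `ψ`-central : `μ∘(A⊗f)∘ψ = μ∘(f⊗A)`. -/
def Entwining.Central (E : Entwining k C A) (f : C →ₗ[k] A) : Prop :=
  LinearMap.mul' k A ∘ₗ lTensor A f ∘ₗ E.ψ = LinearMap.mul' k A ∘ₗ rTensor A f

/-- The convolution product `f*g = μ∘(f⊗g)∘Δ` on `Hom_k(C,A)`. -/
def convMul (f g : C →ₗ[k] A) : C →ₗ[k] A :=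
  LinearMap.mul' k A ∘ₗ TensorProduct.map f g ∘ₗ Coalgebra.comul (R := k)

/-- The convolution unit `η∘ε`. -/
def convOne : C →ₗ[k] A :=
  Algebra.linearMap k A ∘ₗ Coalgebra.counit (R := k)

/-- The braided coalgebra `(C, ς)` is cocommutative: `ς∘ς = id` and `ς∘Δ = Δ`. -/
def Entwining.Cocomm (E : Entwining k C A) : Prop :=
  E.ς ∘ₗ E.ς = LinearMap.id ∧ E.ς ∘ₗ Coalgebra.comul (R := k) = Coalgebra.comul (R := k)

theorem Entwining.Compat.apply {E : Entwining k C A} {f : C →ₗ[k] A} (hf : E.Compat f)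
    (c d : C) : E.ψ (c ⊗ₜ[k] f d) = rTensor C f (E.ς (c ⊗ₜ[k] d)) := by
  simpa using LinearMap.congr_fun hf (c ⊗ₜ[k] d)

theorem Entwining.Compat.add {E : Entwining k C A} {f g : C →ₗ[k] A} (hf : E.Compat f)
    (hg : E.Compat g) : E.Compat (f + g) := by
  unfold Entwining.Compat at *
  rw [lTensor_add, rTensor_add, LinearMap.comp_add, LinearMap.add_comp, hf, hg]

theorem Entwining.Compat.smul {E : Entwining k C A} (a : k) {f : C →ₗ[k] A}
    (hf : E.Compat f) : E.Compat (a • f) := by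
  unfold Entwining.Compat at *
  rw [lTensor_smul, rTensor_smul, LinearMap.comp_smul, LinearMap.smul_comp, hf]

theorem Entwining.compat_convOne (E : Entwining k C A) :
    E.Compat (convOne : C →ₗ[k] A) := by
  refine TensorProduct.ext' fun c d => ?_
  have h : rTensor C (Coalgebra.counit (R := k)) (E.ς (c ⊗ₜ[k] d)) =
      (1 : k) ⊗ₜ[k] (Coalgebra.counit (R := k) d • c) := by
    apply (TensorProduct.lid k C).injective
    simpa using LinearMap.congr_fun E.ς_counit_right (c ⊗ₜ[k] d)
  simp [_root_.convOne, rTensor_comp_apply, h, Algebra.algebraMap_eq_smul_one, E.ψ_one]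

/-- Moving `C` past `f ⊗ g` by `ψ` twice is the same as moving it past `C ⊗ C` by `ς` twice. -/
theorem Entwining.Compat.map_comp {E : Entwining k C A} {f g : C →ₗ[k] A}
    (hf : E.Compat f) (hg : E.Compat g) :
    (TensorProduct.assoc k A A C).symm.toLinearMap
        ∘ₗ lTensor A E.ψ ∘ₗ (TensorProduct.assoc k A C A).toLinearMap
        ∘ₗ rTensor A E.ψ ∘ₗ (TensorProduct.assoc k C A A).symm.toLinearMap
        ∘ₗ lTensor C (TensorProduct.map f g) =
      rTensor C (TensorProduct.map f g) ∘ₗ (TensorProduct.assoc k C C C).symm.toLinearMap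
        ∘ₗ lTensor C E.ς ∘ₗ (TensorProduct.assoc k C C C).toLinearMap ∘ₗ rTensor C E.ς
        ∘ₗ (TensorProduct.assoc k C C C).symm.toLinearMap := by
  refine TensorProduct.ext_threefold' fun c d e => ?_
  simp only [LinearMap.comp_apply, LinearEquiv.coe_coe, lTensor_tmul, rTensor_tmul,
    TensorProduct.map_tmul, TensorProduct.assoc_symm_tmul, hf.apply]
  induction E.ς (c ⊗ₜ[k] d) with
  | zero => simp
  | add x y hx hy => simp only [map_add, TensorProduct.add_tmul, hx, hy]
  | tmul a b =>
    simp only [lTensor_tmul, rTensor_tmul, TensorProduct.assoc_tmul, hg.apply]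
    induction E.ς (b ⊗ₜ[k] e) with
    | zero => simp
    | add x y hx hy => simp only [map_add, TensorProduct.tmul_add, hx, hy]
    | tmul u v => simp

theorem Entwining.Compat.convMul {E : Entwining k C A} {f g : C →ₗ[k] A}
    (hf : E.Compat f) (hg : E.Compat g) : E.Compat (convMul f g) := by
  refine LinearMap.ext fun x => ?_
  have hψ := LinearMap.congr_fun E.ψ_mul
    (lTensor C (TensorProduct.map f g) (lTensor C (Coalgebra.comul (R := k)) x))
  have hm := LinearMap.congr_fun (hf.map_comp hg) (lTensor C (Coalgebra.comul (R := k)) x)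
  have hς := LinearMap.congr_fun E.ς_comul_right x
  simp only [LinearMap.comp_apply] at hψ hm hς
  simp only [_root_.convMul, LinearMap.comp_apply, lTensor_comp, rTensor_comp, hψ, hm, hς]

/-- Proposition 1.18(1): the maps `C → A` compatible with `ψ` form a unital
subalgebra of the convolution algebra `Hom_k(C, A)`. -/
theorem compat_subalgebra (E : Entwining k C A) :
    (∀ f g : C →ₗ[k] A, E.Compat f → E.Compat g → E.Compat (f + g)) ∧
    (∀ (a : k) (f : C →ₗ[k] A), E.Compat f → E.Compat (a • f)) ∧
    E.Compat (convOne : C →ₗ[k] A) ∧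
    (∀ f g : C →ₗ[k] A, E.Compat f → E.Compat g → E.Compat (convMul f g)) := by
  exact ⟨fun _ _ => .add, fun a _ => .smul a, E.compat_convOne, fun _ _ => .convMul⟩
end
end

section
/- Let (C, ς, A, ψ) be an entwining structure over a field k such that the braided coalgebra (C, ς) is cocommutative. If f, g : C → A are linear maps that are both compatible with ψ and ψ-central, then f*g = g*f; that is, the convolution algebra of ψ-compatible ψ-central maps is commutative. -/
open TensorProduct LinearMap

noncomputable section

variable {k C A : Type*} [Field k] [AddCommGroup C] [Module k C] [Coalgebra k C]
  [Ring A] [Algebra k A]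

/-- over a cocommutative braided coalgebra, `ψ`-compatible `ψ`-central maps
commute for the convolution product. -/
theorem compat_central_conv_comm (E : Entwining k C A) (hcc : E.Cocomm)
    (f g : C →ₗ[k] A)
    (hf_compat : E.Compat f) (hf_central : E.Central f)
    (hg_compat : E.Compat g) (hg_central : E.Central g) :
    convMul f g = convMul g f := by
  have key : ∀ x, mul' k A (TensorProduct.map f g x) =
      mul' k A (TensorProduct.map g f (E.ς x)) := fun x => by
    have hcentral := LinearMap.congr_fun hf_central (lTensor C g x)
    have hcompat := LinearMap.congr_fun hg_compat x
    simp only [comp_apply] at hcentral hcompat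
    rw [hcompat] at hcentral
    rw [← rTensor_comp_lTensor, ← lTensor_comp_rTensor, comp_apply, comp_apply]
    exact hcentral.symm
  ext c
  have hcomul := LinearMap.congr_fun hcc.2 c
  simp only [comp_apply] at hcomul
  simp only [_root_.convMul, comp_apply]
  rw [key, hcomul]
end
end

section
/- Let (C, ς, A, ψ) be an entwining structure over a field k. For a linear map g : C → A define T(g) : C⊗A → C⊗A by T(g)(c⊗a) = Σ c₍₁₎ ⊗ g(c₍₂₎)a. Then a linear map f : C → A is compatible with ψ if and only if (C⊗ψ)∘(ς⊗A)∘(C⊗T(f)) = (T(f)⊗C)∘(C⊗ψ)∘(ς⊗A) as maps C⊗C⊗A → C⊗A⊗C. -/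
open TensorProduct LinearMap

noncomputable section

variable {k C A : Type*} [Field k] [AddCommGroup C] [Module k C] [Coalgebra k C]
  [Ring A] [Algebra k A]

/-- `T(g) : C⊗A → C⊗A`, `c⊗a ↦ Σ c₍₁₎ ⊗ g(c₍₂₎)a` (the map `T_A^C` of Lemma 1.20). -/
def Tmap (g : C →ₗ[k] A) : C ⊗[k] A →ₗ[k] C ⊗[k] A :=
  lTensor C (LinearMap.mul' k A) ∘ₗ lTensor C (rTensor A g)
    ∘ₗ (TensorProduct.assoc k C C A).toLinearMap
    ∘ₗ rTensor A (Coalgebra.comul (R := k))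

theorem Tmap_tmul (f : C →ₗ[k] A) (c : C) (a : A) :
    Tmap f (c ⊗ₜ[k] a) =
      lTensor C (LinearMap.mulRight k a ∘ₗ f) (Coalgebra.comul (R := k) c) := by
  simp only [Tmap, LinearMap.comp_apply, LinearEquiv.coe_coe, rTensor_tmul]
  generalize Coalgebra.comul (R := k) c = y
  induction y with
  | zero => simp
  | tmul y₁ y₂ => simp
  | add x y hx hy => simp only [TensorProduct.add_tmul, map_add, hx, hy]

/-- The map `c ⊗ d ↦ (μ⊗C)(f(c) ⊗ ψ(d⊗a))`. -/
def Entwining.actMul (E : Entwining k C A) (f : C →ₗ[k] A) (a : A) : C ⊗[k] C →ₗ[k] A ⊗[k] C :=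
  rTensor C (LinearMap.mul' k A ∘ₗ rTensor A f) ∘ₗ (TensorProduct.assoc k C A C).symm.toLinearMap
    ∘ₗ lTensor C (E.ψ ∘ₗ (TensorProduct.mk k C A).flip a)

theorem Entwining.actMul_tmul (E : Entwining k C A) (f : C →ₗ[k] A) (a : A) (c d : C) :
    E.actMul f a (c ⊗ₜ[k] d) = rTensor C (LinearMap.mulLeft k (f c)) (E.ψ (d ⊗ₜ[k] a)) := by
  simp only [actMul, LinearMap.comp_apply, LinearEquiv.coe_coe, lTensor_tmul, flip_apply,
    TensorProduct.mk_apply]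
  induction E.ψ (d ⊗ₜ[k] a) with
  | zero => simp
  | tmul y₁ y₂ => simp
  | add x y hx hy => simp only [TensorProduct.tmul_add, map_add, hx, hy]

theorem Entwining.ψ_tmul_mul (E : Entwining k C A) (d : C) (b a : A) :
    E.ψ (d ⊗ₜ[k] (b * a)) =
      rTensor C (LinearMap.mul' k A) ((TensorProduct.assoc k A A C).symm
        (lTensor A E.ψ (TensorProduct.assoc k A C A (E.ψ (d ⊗ₜ[k] b) ⊗ₜ[k] a)))) := by
  simpa using LinearMap.congr_fun E.ψ_mul (d ⊗ₜ[k] (b ⊗ₜ[k] a))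

theorem Entwining.Compat.ψ_tmul_apply {E : Entwining k C A} {f : C →ₗ[k] A} (hf : E.Compat f)
    (d c : C) : E.ψ (d ⊗ₜ[k] f c) = rTensor C f (E.ς (d ⊗ₜ[k] c)) := by
  simpa using LinearMap.congr_fun hf (d ⊗ₜ[k] c)

theorem Entwining.Compat.ψ_tmul_mul {E : Entwining k C A} {f : C →ₗ[k] A} (hf : E.Compat f)
    (d c : C) (a : A) :
    E.ψ (d ⊗ₜ[k] (f c * a)) = E.actMul f a (E.ς (d ⊗ₜ[k] c)) := by
  rw [Entwining.ψ_tmul_mul, hf.ψ_tmul_apply]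
  induction E.ς (d ⊗ₜ[k] c) with
  | zero => simp
  | add x y hx hy => simp only [TensorProduct.add_tmul, map_add, hx, hy]
  | tmul x y =>
    simp only [rTensor_tmul, TensorProduct.assoc_tmul, lTensor_tmul, Entwining.actMul_tmul]
    induction E.ψ (y ⊗ₜ[k] a) with
    | zero => simp
    | tmul y₁ y₂ => simp
    | add x y hx hy => simp only [TensorProduct.tmul_add, map_add, hx, hy]

theorem Entwining.ς_tmul_comul (E : Entwining k C A) (d c : C) :
    TensorProduct.assoc k C C C (rTensor C (Coalgebra.comul (R := k)) (E.ς (d ⊗ₜ[k] c))) =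
      lTensor C E.ς (TensorProduct.assoc k C C C (rTensor C E.ς
        ((TensorProduct.assoc k C C C).symm (d ⊗ₜ[k] Coalgebra.comul (R := k) c)))) := by
  simpa using congrArg (TensorProduct.assoc k C C C)
    (LinearMap.congr_fun E.ς_comul_right (d ⊗ₜ[k] c))

theorem Entwining.Compat.braid_Tmap {E : Entwining k C A} {f : C →ₗ[k] A} (hf : E.Compat f)
    (d c : C) (a : A) :
    lTensor C E.ψ (TensorProduct.assoc k C C A (rTensor A E.ς
        ((TensorProduct.assoc k C C A).symm (d ⊗ₜ[k] Tmap f (c ⊗ₜ[k] a))))) =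
      lTensor C (E.actMul f a) (TensorProduct.assoc k C C C
        (rTensor C (Coalgebra.comul (R := k)) (E.ς (d ⊗ₜ[k] c)))) := by
  rw [Entwining.ς_tmul_comul, Tmap_tmul]
  induction Coalgebra.comul (R := k) c with
  | zero => simp
  | add x y hx hy => simp only [TensorProduct.tmul_add, map_add, hx, hy]
  | tmul x y =>
    simp only [lTensor_tmul, TensorProduct.assoc_symm_tmul, rTensor_tmul]
    induction E.ς (d ⊗ₜ[k] x) with
    | zero => simp
    | add x y hx hy => simp only [TensorProduct.add_tmul, map_add, hx, hy]
    | tmul z w => simp [hf.ψ_tmul_mul]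

theorem Entwining.Tmap_braid (E : Entwining k C A) (f : C →ₗ[k] A) (w : C ⊗[k] C) (a : A) :
    TensorProduct.assoc k C A C (rTensor C (Tmap f) ((TensorProduct.assoc k C A C).symm
        (lTensor C E.ψ (TensorProduct.assoc k C C A (w ⊗ₜ[k] a))))) =
      lTensor C (E.actMul f a) (TensorProduct.assoc k C C C
        (rTensor C (Coalgebra.comul (R := k)) w)) := by
  induction w with
  | zero => simp
  | add x y hx hy => simp only [TensorProduct.add_tmul, map_add, hx, hy]
  | tmul x y =>
    simp only [rTensor_tmul, TensorProduct.assoc_tmul, lTensor_tmul]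
    have h (u : C ⊗[k] C) : lTensor C (E.actMul f a) (TensorProduct.assoc k C C C (u ⊗ₜ[k] y)) =
        (TensorProduct.assoc k C A C) (rTensor C
          (lTensor C (LinearMap.mul' k A ∘ₗ rTensor A f)
            ∘ₗ (TensorProduct.assoc k C C A).toLinearMap
            ∘ₗ TensorProduct.mk k (C ⊗[k] C) A u) (E.ψ (y ⊗ₜ[k] a))) := by
      induction u with
      | zero => simp
      | add u v hu hv =>
        simp only [TensorProduct.add_tmul, map_add, hu, hv, LinearMap.comp_add, rTensor_add,
          LinearMap.add_apply]
      | tmul u v =>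
        simp only [TensorProduct.assoc_tmul, lTensor_tmul, Entwining.actMul_tmul]
        induction E.ψ (y ⊗ₜ[k] a) with
        | zero => simp
        | tmul y₁ y₂ => simp
        | add x y hx hy => simp only [TensorProduct.tmul_add, map_add, hx, hy]
    rw [h]
    induction E.ψ (y ⊗ₜ[k] a) with
    | zero => simp
    | add x y hx hy => simp only [TensorProduct.tmul_add, map_add, hx, hy]
    | tmul p q => simp [Tmap, lTensor_comp_apply]

theorem counit_Tmap_one (f : C →ₗ[k] A) (c : C) :
    TensorProduct.lid k A (rTensor A (Coalgebra.counit (R := k)) (Tmap f (c ⊗ₜ[k] (1 : A)))) =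
      f c := by
  have h := congrArg (fun y ↦ f (TensorProduct.lid k C y))
    (Coalgebra.rTensor_counit_comul (R := k) c)
  simp only [TensorProduct.lid_tmul, one_smul] at h
  rw [Tmap_tmul, ← h]
  induction Coalgebra.comul (R := k) c with
  | zero => simp
  | tmul y₁ y₂ => simp
  | add x y hx hy => simp only [map_add, hx, hy]

theorem Entwining.counit_braid (E : Entwining k C A) (d : C) (t : C ⊗[k] A) :
    TensorProduct.lid k (A ⊗[k] C) (rTensor (A ⊗[k] C) (Coalgebra.counit (R := k))
      (lTensor C E.ψ (TensorProduct.assoc k C C A (rTensor A E.ς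
        ((TensorProduct.assoc k C C A).symm (d ⊗ₜ[k] t)))))) =
      E.ψ (d ⊗ₜ[k] TensorProduct.lid k A (rTensor A (Coalgebra.counit (R := k)) t)) := by
  induction t with
  | zero => simp
  | add x y hx hy => simp only [TensorProduct.tmul_add, map_add, hx, hy]
  | tmul c a =>
    have h := LinearMap.congr_fun E.ς_counit_right (d ⊗ₜ[k] c)
    simp only [LinearMap.comp_apply, LinearEquiv.coe_coe, lTensor_tmul,
      TensorProduct.rid_tmul] at h
    simp only [TensorProduct.assoc_symm_tmul, rTensor_tmul, TensorProduct.lid_tmul,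
      ← TensorProduct.smul_tmul, ← h]
    induction E.ς (d ⊗ₜ[k] c) with
    | zero => simp
    | add x y hx hy => simp only [TensorProduct.add_tmul, map_add, hx, hy]
    | tmul z w => simp [← TensorProduct.smul_tmul']

theorem Entwining.counit_Tmap_braid_one (E : Entwining k C A) (f : C →ₗ[k] A) (w : C ⊗[k] C) :
    TensorProduct.lid k (A ⊗[k] C) (rTensor (A ⊗[k] C) (Coalgebra.counit (R := k))
      (TensorProduct.assoc k C A C (rTensor C (Tmap f) ((TensorProduct.assoc k C A C).symm
        (lTensor C E.ψ (TensorProduct.assoc k C C A (w ⊗ₜ[k] (1 : A)))))))) =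
      rTensor C f w := by
  induction w with
  | zero => simp
  | add x y hx hy => simp only [TensorProduct.add_tmul, map_add, hx, hy]
  | tmul c d =>
    simp only [TensorProduct.assoc_tmul, lTensor_tmul, E.ψ_one, TensorProduct.assoc_symm_tmul,
      rTensor_tmul]
    rw [← counit_Tmap_one f c]
    induction Tmap f (c ⊗ₜ[k] (1 : A)) with
    | zero => simp
    | add x y hx hy => simp only [TensorProduct.add_tmul, map_add, hx, hy]
    | tmul z w => simp [TensorProduct.smul_tmul']

/-- `f : C → A` is compatible with `ψ` iff
`(C⊗ψ)∘(ς⊗A)∘(C⊗T(f)) = (T(f)⊗C)∘(C⊗ψ)∘(ς⊗A)`. -/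
theorem compat_iff_Tmap (E : Entwining k C A) (f : C →ₗ[k] A) :
    E.Compat f ↔
      lTensor C E.ψ ∘ₗ (TensorProduct.assoc k C C A).toLinearMap
          ∘ₗ rTensor A E.ς ∘ₗ (TensorProduct.assoc k C C A).symm.toLinearMap
          ∘ₗ lTensor C (Tmap f) =
        (TensorProduct.assoc k C A C).toLinearMap ∘ₗ rTensor C (Tmap f)
          ∘ₗ (TensorProduct.assoc k C A C).symm.toLinearMap
          ∘ₗ lTensor C E.ψ ∘ₗ (TensorProduct.assoc k C C A).toLinearMap
          ∘ₗ rTensor A E.ς ∘ₗ (TensorProduct.assoc k C C A).symm.toLinearMap := by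
  constructor
  · intro hf
    refine TensorProduct.ext' fun d t ↦ ?_
    induction t with
    | zero => simp
    | add x y hx hy => simp only [TensorProduct.tmul_add, map_add, hx, hy]
    | tmul c a =>
      simp only [LinearMap.comp_apply, LinearEquiv.coe_coe, lTensor_tmul,
        TensorProduct.assoc_symm_tmul, rTensor_tmul]
      rw [hf.braid_Tmap, E.Tmap_braid]
  · intro h
    refine TensorProduct.ext' fun d c ↦ ?_
    have h₁ := LinearMap.congr_fun h (d ⊗ₜ[k] (c ⊗ₜ[k] (1 : A)))
    simp only [LinearMap.comp_apply, LinearEquiv.coe_coe, lTensor_tmul,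
      TensorProduct.assoc_symm_tmul, rTensor_tmul] at h₁
    have h₂ := congrArg (fun y ↦ TensorProduct.lid k (A ⊗[k] C)
      (rTensor (A ⊗[k] C) (Coalgebra.counit (R := k)) y)) h₁
    simp only [E.counit_braid, E.counit_Tmap_braid_one, counit_Tmap_one] at h₂
    simpa using h₂
end
end
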